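/- For every integer t ≥ 1, every finite simple graph G that does not admit a totally odd immersion of K_t has a set of edges F ⊆ E(G) such that the subgraph of G with edge set F is bipartite and the graph D obtained from G by deleting the edges in F is (686000·t + 31000000)-degenerate, i.e., every nonempty subgraph of D has a vertex of degree at most 686000·t + 31000000. -/

import Mathlib

open SimpleGraph

/-- An immersion of `H` in `G`: an injection `φ` of the vertices of `H` into `G`
(the branch vertices), together with, for each edge `uv` of `H`, a trail in `G`
from `φ u` to `φ v` (the branch trails), such that the branch trails are
pairwise edge-disjoint.  The trail assigned to the reversed adjacency is the
reversed trail, so there is one branch trail per edge of `H`. -/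
structure Immersion {V : Type*} {W : Type*} (G : SimpleGraph V) (H : SimpleGraph W) where
  φ : W ↪ V
  trail : ∀ ⦃u v : W⦄, H.Adj u v → G.Walk (φ u) (φ v)
  isTrail : ∀ ⦃u v : W⦄ (h : H.Adj u v), (trail h).IsTrail
  symm : ∀ ⦃u v : W⦄ (h : H.Adj u v), trail h.symm = (trail h).reverse
  disjoint : ∀ ⦃u v a b : W⦄ (h₁ : H.Adj u v) (h₂ : H.Adj a b),
      s(u, v) ≠ s(a, b) → List.Disjoint (trail h₁).edges (trail h₂).edges

/-- `G` admits an immersion of `H`. -/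
def HasImmersion {V W : Type*} (G : SimpleGraph V) (H : SimpleGraph W) : Prop :=
  Nonempty (Immersion G H)

/-- `G` admits a totally odd immersion of `H`: every branch trail has odd length. -/
def HasTotallyOddImmersion {V W : Type*} (G : SimpleGraph V) (H : SimpleGraph W) : Prop :=
  ∃ I : Immersion G H, ∀ ⦃u v : W⦄ (h : H.Adj u v), Odd (I.trail h).length

/-- `G` admits a totally even immersion of `H`: every branch trail has even length. -/
def HasTotallyEvenImmersion {V W : Type*} (G : SimpleGraph V) (H : SimpleGraph W) : Prop :=
  ∃ I : Immersion G H, ∀ ⦃u v : W⦄ (h : H.Adj u v), Even (I.trail h).length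

section

namespace TOI
open SimpleGraph
open scoped Classical
set_option linter.unusedSectionVars false
set_option linter.unusedVariables false

/-- connection inside a set of edges -/
def Conn {V : Type*} (S : Set (Sym2 V)) (x y : V) : Prop := (fromEdgeSet S).Reachable x y

theorem Conn.refl {V : Type*} (S : Set (Sym2 V)) (x : V) : Conn S x x := Reachable.refl _

theorem Conn.symm {V : Type*} {S : Set (Sym2 V)} {x y : V} (h : Conn S x y) : Conn S y x :=
  Reachable.symm h

theorem Conn.trans {V : Type*} {S : Set (Sym2 V)} {x y z : V} (h : Conn S x y)
    (h' : Conn S y z) : Conn S x z := Reachable.trans h h'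

theorem Conn.mono {V : Type*} {S T : Set (Sym2 V)} (hST : S ⊆ T) {x y : V}
    (h : Conn S x y) : Conn T x y :=
  Reachable.mono (fromEdgeSet_mono hST) h

theorem Conn.edge {V : Type*} {S : Set (Sym2 V)} {x y : V} (h : s(x, y) ∈ S) : Conn S x y := by
  by_cases hxy : x = y
  · subst hxy; exact Conn.refl _ _
  · exact Adj.reachable (by simp [fromEdgeSet_adj, h, hxy])

theorem Conn.bind {V : Type*} {S T : Set (Sym2 V)} {x y : V} (h : Conn S x y)
    (hT : ∀ a b, s(a, b) ∈ S → a ≠ b → Conn T a b) : Conn T x y := by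
  obtain ⟨p⟩ := h
  induction p with
  | nil => exact Conn.refl _ _
  | cons hadj p ih =>
    rw [fromEdgeSet_adj] at hadj
    exact (hT _ _ hadj.1 hadj.2).trans ih

/-- weak immersion of a graph on the same vertex set -/
def Imm {V : Type*} (G H : SimpleGraph V) : Prop :=
  ∃ S : Sym2 V → Set (Sym2 V), (∀ e ∈ H.edgeSet, S e ⊆ G.edgeSet) ∧
    (∀ e ∈ H.edgeSet, ∀ f ∈ H.edgeSet, e ≠ f → Disjoint (S e) (S f)) ∧
    ∀ x y, H.Adj x y → Conn (S s(x, y)) x y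

theorem Imm.of_le {V : Type*} {G H : SimpleGraph V} (h : H ≤ G) : Imm G H := by
  refine ⟨fun e => {e}, ?_, ?_, ?_⟩
  · intro e he; simpa using edgeSet_mono h he
  · intro e _ f _ hef; simpa using hef
  · intro x y _; exact Conn.edge rfl

theorem Imm.refl {V : Type*} (G : SimpleGraph V) : Imm G G := Imm.of_le le_rfl

theorem Imm.trans {V : Type*} {G H K : SimpleGraph V} (h1 : Imm G H) (h2 : Imm H K) :
    Imm G K := by
  obtain ⟨S, hS1, hS2, hS3⟩ := h1
  obtain ⟨T, hT1, hT2, hT3⟩ := h2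
  refine ⟨fun e => ⋃ f ∈ T e, S f, ?_, ?_, ?_⟩
  · intro e he
    simp only [Set.iUnion_subset_iff]
    intro f hf
    exact hS1 f (hT1 e he hf)
  · intro e he e' he' hne
    rw [Set.disjoint_left]
    intro g hg hg'
    simp only [Set.mem_iUnion] at hg hg'
    obtain ⟨f, hf, hgf⟩ := hg
    obtain ⟨f', hf', hgf'⟩ := hg'
    have hff : f ≠ f' := fun h' => Set.disjoint_left.1 (hT2 _ he _ he' hne) hf (h' ▸ hf')
    exact Set.disjoint_left.1 (hS2 _ (hT1 _ he hf) _ (hT1 _ he' hf') hff) hgf hgf'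
  · intro x y hxy
    refine (hT3 x y hxy).bind ?_
    intro a b hab hne
    have := hT1 _ (by simpa using hxy) hab
    refine (hS3 a b (by simpa using this)).mono ?_
    exact Set.subset_biUnion_of_mem (u := S) hab

/-- immersion of the complete graph -/
def HasK {V : Type*} (n : ℕ) (G : SimpleGraph V) : Prop :=
  ∃ φ : Fin n → V, Function.Injective φ ∧ ∃ S : Fin n × Fin n → Set (Sym2 V),
    (∀ p, p.1 < p.2 → S p ⊆ G.edgeSet) ∧
    (∀ p q, p.1 < p.2 → q.1 < q.2 → p ≠ q → Disjoint (S p) (S q)) ∧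
    ∀ p, p.1 < p.2 → Conn (S p) (φ p.1) (φ p.2)

theorem HasK.of_imm {V : Type*} {n : ℕ} {G H : SimpleGraph V} (h1 : Imm G H) (h2 : HasK n H) :
    HasK n G := by
  obtain ⟨S, hS1, hS2, hS3⟩ := h1
  obtain ⟨φ, hφ, T, hT1, hT2, hT3⟩ := h2
  refine ⟨φ, hφ, fun e => ⋃ f ∈ T e, S f, ?_, ?_, ?_⟩
  · intro e he
    simp only [Set.iUnion_subset_iff]
    intro f hf
    exact hS1 f (hT1 e he hf)
  · intro e e' he he' hne
    rw [Set.disjoint_left]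
    intro g hg hg'
    simp only [Set.mem_iUnion] at hg hg'
    obtain ⟨f, hf, hgf⟩ := hg
    obtain ⟨f', hf', hgf'⟩ := hg'
    have hff : f ≠ f' := fun h' => Set.disjoint_left.1 (hT2 _ _ he he' hne) hf (h' ▸ hf')
    exact Set.disjoint_left.1 (hS2 _ (hT1 _ he hf) _ (hT1 _ he' hf') hff) hgf hgf'
  · intro p hp
    refine (hT3 p hp).bind ?_
    intro a b hab hne
    have := hT1 _ hp hab
    refine (hS3 a b (by simpa using this)).mono ?_
    exact Set.subset_biUnion_of_mem (u := S) hab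

/-- greedy choice with conflicts -/
theorem greedy {ι γ : Type*} [Fintype ι] (C : ι → Finset γ) (R : ι → γ → ι → γ → Prop)
    (hsymm : ∀ k c k' c', R k c k' c' → R k' c' k c)
    (w : ι → ι → ℕ)
    (hw : ∀ k k', k ≠ k' → ∀ c' ∈ C k', ((C k).filter (fun c => R k c k' c')).card ≤ w k k')
    (hC : ∀ k, ∑ k', w k k' < (C k).card) :
    ∃ c : ι → γ, (∀ k, c k ∈ C k) ∧ ∀ k k', k ≠ k' → ¬ R k (c k) k' (c k') := by
  have key : ∀ s : Finset ι, ∃ c : ι → γ, (∀ k, c k ∈ C k) ∧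
      ∀ k ∈ s, ∀ k' ∈ s, k ≠ k' → ¬ R k (c k) k' (c k') := by
    intro s
    induction s using Finset.induction_on with
    | empty =>
      have : ∀ k, ∃ c, c ∈ C k := fun k =>
        Finset.card_pos.1 (lt_of_le_of_lt (Nat.zero_le _) (hC k))
      choose c hc using this
      exact ⟨c, hc, by simp⟩
    | insert a s ha ih =>
      obtain ⟨c, hc, hR⟩ := ih
      have hex : ∃ x ∈ C a, ∀ k ∈ s, ¬ R a x k (c k) := by
        by_contra hcon
        push Not at hcon
        have hsub : C a ⊆ s.biUnion (fun k => (C a).filter (fun x => R a x k (c k))) := by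
          intro x hx
          obtain ⟨k, hk, hk'⟩ := hcon x hx
          simp only [Finset.mem_biUnion, Finset.mem_filter]
          exact ⟨k, hk, hx, hk'⟩
        have h1 := Finset.card_le_card hsub
        have h2 := Finset.card_biUnion_le (s := s)
          (t := (fun k => (C a).filter (fun x => R a x k (c k))))
        have h3 : ∑ k ∈ s, ((C a).filter (fun x => R a x k (c k))).card ≤ ∑ k ∈ s, w a k := by
          apply Finset.sum_le_sum
          intro k hk
          exact hw a k (fun h => ha (h ▸ hk)) _ (hc k)
        have h4 : ∑ k ∈ s, w a k ≤ ∑ k, w a k :=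
          Finset.sum_le_sum_of_subset (Finset.subset_univ s)
        have h5 := hC a
        omega
      obtain ⟨x, hx, hxR⟩ := hex
      refine ⟨Function.update c a x, ?_, ?_⟩
      · intro k
        by_cases hk : k = a
        · subst hk; simpa using hx
        · simpa [hk] using hc k
      · intro k hk k' hk' hne
        rw [Finset.mem_insert] at hk hk'
        by_cases h1 : k = a
        · subst h1
          have h2 : k' ≠ k := fun h => hne h.symm
          have h3 : k' ∈ s := by tauto
          simp only [Function.update_self, Function.update_of_ne h2]
          exact hxR k' h3
        · by_cases h2 : k' = a
          · subst h2
            have h3 : k ∈ s := by tauto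
            simp only [Function.update_self, Function.update_of_ne h1]
            exact fun h => hxR k h3 (hsymm _ _ _ _ h)
          · simp only [Function.update_of_ne h1, Function.update_of_ne h2]
            exact hR k (by tauto) k' (by tauto) hne
  obtain ⟨c, hc, hR⟩ := key Finset.univ
  exact ⟨c, hc, fun k k' h => hR k (by simp) k' (by simp) h⟩

/-- ordered pairs -/
abbrev Task (n : ℕ) := {p : Fin n × Fin n // p.1 < p.2}

/-- tasks sharing a branch index -/
def Shares {n : ℕ} (p q : Task n) : Prop :=
  p.1.1 = q.1.1 ∨ p.1.1 = q.1.2 ∨ p.1.2 = q.1.1 ∨ p.1.2 = q.1.2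

theorem Shares.symm {n : ℕ} {p q : Task n} (h : Shares p q) : Shares q p := by
  unfold Shares at *; tauto

theorem card_fst {n : ℕ} (a : Fin n) :
    (Finset.univ.filter (fun q : Task n => q.1.1 = a)).card ≤ n := by
  have : (Finset.univ.filter (fun q : Task n => q.1.1 = a)).card ≤
      (Finset.univ : Finset (Fin n)).card := by
    apply Finset.card_le_card_of_injOn (fun q => q.1.2) (by intro _ _; simp)
    intro q hq q' hq' h
    simp only [Finset.coe_filter, Finset.mem_univ, true_and, Set.mem_ofPred_eq] at hq hq'
    apply Subtype.ext; apply Prod.ext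
    · rw [hq, hq']
    · exact h
  simpa using this

theorem card_snd {n : ℕ} (a : Fin n) :
    (Finset.univ.filter (fun q : Task n => q.1.2 = a)).card ≤ n := by
  have : (Finset.univ.filter (fun q : Task n => q.1.2 = a)).card ≤
      (Finset.univ : Finset (Fin n)).card := by
    apply Finset.card_le_card_of_injOn (fun q => q.1.1) (by intro _ _; simp)
    intro q hq q' hq' h
    simp only [Finset.coe_filter, Finset.mem_univ, true_and, Set.mem_ofPred_eq] at hq hq'
    apply Subtype.ext; apply Prod.ext
    · exact h
    · rw [hq, hq']
  simpa using this

theorem card_shares {n : ℕ} (p : Task n) :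
    (Finset.univ.filter (fun q : Task n => Shares p q)).card ≤ 4 * n := by
  have hsub : Finset.univ.filter (fun q : Task n => Shares p q) ⊆
      ((Finset.univ.filter (fun q : Task n => q.1.1 = p.1.1)) ∪
      (Finset.univ.filter (fun q : Task n => q.1.2 = p.1.1))) ∪
      ((Finset.univ.filter (fun q : Task n => q.1.1 = p.1.2)) ∪
      (Finset.univ.filter (fun q : Task n => q.1.2 = p.1.2))) := by
    intro q hq
    have hq := (Finset.mem_filter.1 hq).2
    simp only [Finset.mem_filter, Finset.mem_univ, true_and, Finset.mem_union]
    unfold Shares at hq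
    rcases hq with h | h | h | h <;> simp [h]
  have h0 := Finset.card_le_card hsub
  have h1 := Finset.card_union_le ((Finset.univ.filter (fun q : Task n => q.1.1 = p.1.1)) ∪
      (Finset.univ.filter (fun q : Task n => q.1.2 = p.1.1)))
      ((Finset.univ.filter (fun q : Task n => q.1.1 = p.1.2)) ∪
      (Finset.univ.filter (fun q : Task n => q.1.2 = p.1.2)))
  have h2 := Finset.card_union_le (Finset.univ.filter (fun q : Task n => q.1.1 = p.1.1))
      (Finset.univ.filter (fun q : Task n => q.1.2 = p.1.1))
  have h3 := Finset.card_union_le (Finset.univ.filter (fun q : Task n => q.1.1 = p.1.2))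
      (Finset.univ.filter (fun q : Task n => q.1.2 = p.1.2))
  have h4 := card_fst (n := n) p.1.1
  have h5 := card_fst (n := n) p.1.2
  have h6 := card_snd (n := n) p.1.1
  have h7 := card_snd (n := n) p.1.2
  omega

theorem hasK_of_tasks {V : Type*} {n : ℕ} {G : SimpleGraph V} (φ : Fin n → V)
    (hφ : Function.Injective φ) (S : Task n → Set (Sym2 V))
    (h1 : ∀ p, S p ⊆ G.edgeSet) (h2 : ∀ p q, p ≠ q → Disjoint (S p) (S q))
    (h3 : ∀ p, Conn (S p) (φ p.1.1) (φ p.1.2)) : HasK n G := by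
  refine ⟨φ, hφ, fun p => if h : p.1 < p.2 then S ⟨p, h⟩ else ∅, ?_, ?_, ?_⟩
  · intro p hp; simp only [hp, dite_true]; exact h1 _
  · intro p q hp hq hne; simp only [hp, hq, dite_true]
    apply h2; intro h; exact hne (Subtype.ext_iff.1 h)
  · intro p hp; simp only [hp, dite_true]; exact h3 ⟨p, hp⟩

variable {V : Type*} [Fintype V]

/-- neighbours as a finset -/
noncomputable def nb (H : SimpleGraph V) (x : V) : Finset V := Finset.univ.filter (H.Adj x)

@[simp] theorem mem_nb {H : SimpleGraph V} {x y : V} : y ∈ nb H x ↔ H.Adj x y := by simp [nb]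

/-- degree -/
noncomputable def dg (H : SimpleGraph V) (x : V) : ℕ := (nb H x).card

/-- Branch vertices with many common neighbours. -/
theorem L2 {n : ℕ} {G : SimpleGraph V} (φ : Fin n → V)
    (hφ : Function.Injective φ) (N : Finset V) (hN : ∀ i, φ i ∉ N)
    (h : ∀ i j, i ≠ j → 4 * n < (nb G (φ i) ∩ nb G (φ j) ∩ N).card) : HasK n G := by
  obtain ⟨c, hc, hR⟩ := greedy (ι := Task n)
    (fun p => nb G (φ p.1.1) ∩ nb G (φ p.1.2) ∩ N)
    (fun p x q y => Shares p q ∧ x = y) (by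
      intro p x q y h; exact ⟨h.1.symm, h.2.symm⟩)
    (fun p q => if Shares p q then 1 else 0) (by
      intro p q _ y _
      by_cases hpq : Shares p q
      · simp only [hpq, true_and, if_true]
        refine (Finset.card_le_card (t := {y}) ?_).trans (by simp)
        intro x; simp
      · simp [hpq]) (by
      intro p
      have h1 := card_shares p
      have h2 := h p.1.1 p.1.2 p.2.ne
      rw [Finset.sum_ite]
      simp only [Finset.sum_const, smul_eq_mul, mul_one, mul_zero, add_zero]
      omega)
  have hc' : ∀ p, G.Adj (φ p.1.1) (c p) ∧ G.Adj (φ p.1.2) (c p) ∧ c p ∈ N := by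
    intro p; have := hc p; simp only [Finset.mem_inter, mem_nb] at this; tauto
  refine hasK_of_tasks φ hφ (fun p => {s(φ p.1.1, c p), s(φ p.1.2, c p)}) ?_ ?_ ?_
  · intro p e he
    rcases he with rfl | rfl
    · exact (hc' p).1
    · exact (hc' p).2.1
  · intro p q hpq
    have hne : ∀ i q, φ i ≠ c q := fun i q h => hN i (h ▸ (hc' q).2.2)
    have hfin : ∀ i j, (i = p.1.1 ∨ i = p.1.2) → (j = q.1.1 ∨ j = q.1.2) →
        s(φ i, c p) ≠ s(φ j, c q) := by
      intro i j hi hj he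
      rw [Sym2.eq_iff] at he
      rcases he with ⟨h1, h2⟩ | ⟨h1, h2⟩
      · refine hR p q hpq ⟨?_, h2⟩
        have := hφ h1
        subst this
        unfold Shares
        rcases hi with rfl | rfl <;> rcases hj with h | h <;> simp [h]
      · exact hne _ _ h1
    rw [Set.disjoint_left]
    intro e he he'
    simp only [Set.mem_insert_iff, Set.mem_singleton_iff] at he he'
    rcases he with rfl | rfl <;> rcases he' with h | h <;>
      exact hfin _ _ (by simp) (by simp) h
  · intro p
    refine Conn.trans (y := c p) (Conn.edge (by simp)) (Conn.symm (Conn.edge (by simp)))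

theorem hasK_of_clique {n : ℕ} {G : SimpleGraph V} (X : Finset V) (hX : n ≤ X.card)
    (h : ∀ x ∈ X, ∀ y ∈ X, x ≠ y → G.Adj x y) : HasK n G := by
  obtain ⟨Y, hY, hYc⟩ := Finset.exists_subset_card_eq hX
  let f := Y.equivFinOfCardEq hYc
  have hinj : Function.Injective (fun i => (f.symm i : V)) := by
    intro i j hij; exact f.symm.injective (Subtype.ext hij)
  refine hasK_of_tasks (fun i => (f.symm i : V)) hinj
    (fun p => {s((f.symm p.1.1 : V), (f.symm p.1.2 : V))}) ?_ ?_ ?_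
  · intro p e he
    rw [Set.mem_singleton_iff] at he
    subst he
    exact h _ (hY (f.symm p.1.1).2) _ (hY (f.symm p.1.2).2) (fun h => p.2.ne (hinj h))
  · intro p q hpq
    rw [Set.disjoint_singleton]
    intro he
    rw [Sym2.eq_iff] at he
    apply hpq
    rcases he with ⟨h1, h2⟩ | ⟨h1, h2⟩
    · exact Subtype.ext (Prod.ext (hinj h1) (hinj h2))
    · have h1 := hinj h1
      have h2 := hinj h2
      have h3 := p.2; have h4 := q.2
      rw [h1, h2] at h3
      exact absurd h3 (not_lt.2 h4.le)
  · intro p; exact Conn.edge (by simp)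

end TOI

end

section

namespace TOI
open SimpleGraph
open scoped Classical
set_option linter.unusedSectionVars false
set_option linter.unusedVariables false
variable {V : Type*} [Fintype V]

theorem exists_fin_of_card {n : ℕ} {X : Finset V} (h : n ≤ X.card) :
    ∃ φ : Fin n → V, Function.Injective φ ∧ ∀ i, φ i ∈ X := by
  obtain ⟨Y, hY, hYc⟩ := Finset.exists_subset_card_eq h
  let f := Y.equivFinOfCardEq hYc
  exact ⟨fun i => (f.symm i : V), fun i j hij => f.symm.injective (Subtype.ext hij),
    fun i => hY (f.symm i).2⟩

theorem card_union_inter (A B : Finset V) : (A ∪ B).card + (A ∩ B).card = A.card + B.card :=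
  Finset.card_union_add_card_inter A B

theorem lemmaA {n : ℕ} (hn : 1 ≤ n) {G : SimpleGraph V} (X N : Finset V) (hX : 8 * n ≤ X.card)
    (hN : N.card ≤ 1000 * n) (h : ∀ x ∈ X, 400 * n ≤ (nb G x ∩ N).card) : HasK n G := by
  obtain ⟨X, hXs, hXc⟩ := Finset.exists_subset_card_eq hX
  replace h := fun x hx => h x (hXs hx)
  clear hXs hX
  set N' := N \ X with hN'
  have hN'c : N'.card ≤ 1000 * n := (Finset.card_le_card Finset.sdiff_subset).trans hN
  have hdeg : ∀ x ∈ X, 392 * n ≤ (nb G x ∩ N').card := by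
    intro x hx
    have h1 := h x hx
    have h2 : nb G x ∩ N ⊆ (nb G x ∩ N') ∪ X := by
      intro y; simp only [hN', Finset.mem_inter, Finset.mem_union, Finset.mem_sdiff]; tauto
    have h3 := Finset.card_le_card h2
    have h4 := Finset.card_union_le (nb G x ∩ N') X
    omega
  let good : V → V → Prop := fun x y => 20 * n ≤ (nb G x ∩ nb G y ∩ N').card
  have good_symm : ∀ x y, good x y → good y x := by
    intro x y hxy
    simp only [good] at *
    rwa [Finset.inter_comm (nb G y)]
  have hthree : ∀ x ∈ X, ∀ y ∈ X, ∀ z ∈ X, ¬ good x y → ¬ good x z → good y z := by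
    intro x hx y hy z hz h1 h2
    by_contra h3
    simp only [good, not_le] at h1 h2 h3
    set A := nb G x ∩ N'
    set B := nb G y ∩ N'
    set C := nb G z ∩ N'
    have e1 := card_union_inter (A ∪ B) C
    have e2 := card_union_inter A B
    have e3 : ((A ∪ B) ∩ C).card ≤ (A ∩ C).card + (B ∩ C).card := by
      rw [Finset.union_inter_distrib_right]; exact Finset.card_union_le _ _
    have i1 : A ∩ B = nb G x ∩ nb G y ∩ N' := by ext; simp only [A, B, Finset.mem_inter]; tauto
    have i2 : A ∩ C = nb G x ∩ nb G z ∩ N' := by ext; simp only [A, C, Finset.mem_inter]; tauto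
    have i3 : B ∩ C = nb G y ∩ nb G z ∩ N' := by ext; simp only [B, C, Finset.mem_inter]; tauto
    rw [i2, i3] at e3
    rw [i1] at e2
    have e4 : ((A ∪ B) ∪ C).card ≤ N'.card := by
      apply Finset.card_le_card; intro w; simp [A, B, C]; tauto
    have d1 : 392 * n ≤ A.card := hdeg x hx
    have d2 : 392 * n ≤ B.card := hdeg y hy
    have d3 : 392 * n ≤ C.card := hdeg z hz
    omega
  have hXN' : ∀ x ∈ X, x ∉ N' := by intro x hx; simp [hN', hx]
  by_cases hcase : ∃ x ∈ X, n ≤ ((X.erase x).filter (fun y => ¬ good x y)).card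
  · obtain ⟨x, hx, hc⟩ := hcase
    obtain ⟨φ, hφ, hφm⟩ := exists_fin_of_card hc
    simp only [Finset.mem_filter, Finset.mem_erase] at hφm
    refine L2 φ hφ N' (fun i => hXN' _ (hφm i).1.2) ?_
    intro i j hij
    have := hthree x hx _ (hφm i).1.2 _ (hφm j).1.2 (hφm i).2 (hφm j).2
    simp only [good] at this
    omega
  push Not at hcase
  obtain ⟨φ, hφ, hφm⟩ := exists_fin_of_card (n := n) (X := X) (by omega)
  set Z := X \ Finset.univ.image φ with hZ
  have hZc : 7 * n ≤ Z.card := by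
    have h1 : X.card - (Finset.univ.image φ).card ≤ Z.card :=
      Finset.le_card_sdiff (Finset.univ.image φ) X
    have h2 : (Finset.univ.image φ).card ≤ n := by
      simpa using (Finset.card_image_le (s := (Finset.univ : Finset (Fin n))) (f := φ))
    omega
  have hZX : ∀ z ∈ Z, z ∈ X := fun z hz => (Finset.mem_sdiff.1 hz).1
  have hZφ : ∀ i, ∀ z ∈ Z, φ i ≠ z := by
    intro i z hz he
    refine (Finset.mem_sdiff.1 hz).2 ?_
    rw [← he]; simp
  obtain ⟨z, hz, hzR⟩ := greedy (ι := Task n)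
    (fun p => Z.filter (fun z => good (φ p.1.1) z ∧ good (φ p.1.2) z))
    (fun p x q y => Shares p q ∧ x = y) (by
      intro p x q y h; exact ⟨h.1.symm, h.2.symm⟩)
    (fun p q => if Shares p q then 1 else 0) (by
      intro p q _ y _
      by_cases hpq : Shares p q
      · simp only [hpq, true_and, if_true]
        refine (Finset.card_le_card (t := {y}) ?_).trans (by simp)
        intro x; simp
      · simp [hpq]) (by
      intro p
      have h1 := card_shares p
      rw [Finset.sum_ite]
      simp only [Finset.sum_const, smul_eq_mul, mul_one, mul_zero, add_zero]
      have h2 : Z ⊆ Z.filter (fun z => good (φ p.1.1) z ∧ good (φ p.1.2) z) ∪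
          ((X.erase (φ p.1.1)).filter (fun y => ¬ good (φ p.1.1) y) ∪
          (X.erase (φ p.1.2)).filter (fun y => ¬ good (φ p.1.2) y)) := by
        intro y hy
        have := hZX y hy
        have := hZφ p.1.1 y hy
        have := hZφ p.1.2 y hy
        simp only [Finset.mem_union, Finset.mem_filter, Finset.mem_erase]
        tauto
      have h3 := Finset.card_le_card h2
      have h4 := Finset.card_union_le (Z.filter (fun z => good (φ p.1.1) z ∧ good (φ p.1.2) z))
          ((X.erase (φ p.1.1)).filter (fun y => ¬ good (φ p.1.1) y) ∪
          (X.erase (φ p.1.2)).filter (fun y => ¬ good (φ p.1.2) y))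
      have h5 := Finset.card_union_le ((X.erase (φ p.1.1)).filter (fun y => ¬ good (φ p.1.1) y))
          ((X.erase (φ p.1.2)).filter (fun y => ¬ good (φ p.1.2) y))
      have h6 := hcase _ (hφm p.1.1)
      have h7 := hcase _ (hφm p.1.2)
      omega)
  have hzZ : ∀ p, z p ∈ Z := fun p => (Finset.mem_filter.1 (hz p)).1
  let en : Task n × Bool → Fin n := fun q => if q.2 then q.1.1.1 else q.1.1.2
  have hgood : ∀ q : Task n × Bool, good (φ (en q)) (z q.1) := by
    rintro ⟨p, b⟩
    have := (Finset.mem_filter.1 (hz p)).2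
    cases b <;> simp [en, this]
  let Rel : Task n × Bool → Task n × Bool → Prop := fun k k' => en k = en k' ∨ z k.1 = z k'.1
  have hRel_symm : ∀ k k', Rel k k' → Rel k' k := by
    intro k k' h; simp only [Rel] at *; rcases h with h | h <;> simp [h]
  have hcount : ∀ k, (Finset.univ.filter (fun k' => Rel k k')).card ≤ 4 * n := by
    intro k
    have hs : Finset.univ.filter (fun k' => Rel k k') ⊆
        ((Finset.univ.filter (fun q : Task n => q.1.1 = en k)).image (fun q => (q, true)) ∪
        (Finset.univ.filter (fun q : Task n => q.1.2 = en k)).image (fun q => (q, false))) ∪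
        (Finset.univ.filter (fun q : Task n => z q = z k.1)) ×ˢ (Finset.univ : Finset Bool) := by
      rintro ⟨q, b⟩ hq
      have hq := (Finset.mem_filter.1 hq).2
      simp only [Rel] at hq
      rcases hq with hq | hq
      · cases b
        · simp only [en] at hq ⊢; simp at hq; simp [hq]
        · simp only [en] at hq ⊢; simp at hq; simp [hq]
      · simp [hq]
    have h1 := Finset.card_le_card hs
    have h2 : (Finset.univ.filter (fun q : Task n => z q = z k.1)).card ≤ n := by
      have : (Finset.univ.filter (fun q : Task n => z q = z k.1)).card ≤
          (Finset.univ : Finset (Fin n)).card := by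
        apply Finset.card_le_card_of_injOn (fun q => q.1.1) (by intro _ _; simp)
        intro q hq q' hq' h
        simp only [Finset.coe_filter, Finset.mem_univ, true_and, Set.mem_ofPred_eq] at hq hq'
        by_contra hne
        exact hzR q q' hne ⟨Or.inl h, hq.trans hq'.symm⟩
      simpa using this
    have h3 := Finset.card_union_le
        ((Finset.univ.filter (fun q : Task n => q.1.1 = en k)).image (fun q => (q, true)) ∪
        (Finset.univ.filter (fun q : Task n => q.1.2 = en k)).image (fun q => (q, false)))
        ((Finset.univ.filter (fun q : Task n => z q = z k.1)) ×ˢ (Finset.univ : Finset Bool))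
    have h4 := Finset.card_union_le
        ((Finset.univ.filter (fun q : Task n => q.1.1 = en k)).image (fun q => (q, true)))
        ((Finset.univ.filter (fun q : Task n => q.1.2 = en k)).image (fun q => (q, false)))
    have h5 := Finset.card_image_le (s := Finset.univ.filter (fun q : Task n => q.1.1 = en k))
      (f := fun q => (q, true))
    have h6 := Finset.card_image_le (s := Finset.univ.filter (fun q : Task n => q.1.2 = en k))
      (f := fun q => (q, false))
    have h7 := card_fst (en k)
    have h8 := card_snd (en k)
    rw [Finset.card_product] at h3
    simp only [Finset.card_univ, Fintype.card_bool] at h3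
    omega
  obtain ⟨w, hw, hwR⟩ := greedy (ι := Task n × Bool)
    (fun k => nb G (φ (en k)) ∩ nb G (z k.1) ∩ N')
    (fun p x q y => Rel p q ∧ x = y) (by
      intro p x q y h; exact ⟨hRel_symm _ _ h.1, h.2.symm⟩)
    (fun p q => if Rel p q then 1 else 0) (by
      intro p q _ y _
      by_cases hpq : Rel p q
      · simp only [hpq, true_and, if_true]
        refine (Finset.card_le_card (t := {y}) ?_).trans (by simp)
        intro x; simp
      · simp [hpq]) (by
      intro k
      have h1 := hcount k
      have h2 := hgood k
      rw [Finset.sum_ite]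
      simp only [Finset.sum_const, smul_eq_mul, mul_one, mul_zero, add_zero]
      simp only [good] at h2
      omega)
  have hw' : ∀ k, G.Adj (φ (en k)) (w k) ∧ G.Adj (z k.1) (w k) ∧ w k ∈ N' := by
    intro k; have := hw k; simp only [Finset.mem_inter, mem_nb] at this; tauto
  refine hasK_of_tasks φ hφ
    (fun p => {e | ∃ b, e = s(φ (en (p, b)), w (p, b)) ∨ e = s(z p, w (p, b))}) ?_ ?_ ?_
  · rintro p e ⟨b, rfl | rfl⟩
    · exact (hw' (p, b)).1
    · exact (hw' (p, b)).2.1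
  · intro p q hpq
    rw [Set.disjoint_left]
    have hkey : ∀ x ∈ X, ∀ y ∈ X, ∀ k k', s(x, w k) = s(y, w k') → x = y ∧ w k = w k' := by
      intro x hx y hy k k' he
      rw [Sym2.eq_iff] at he
      rcases he with h | ⟨h1, h2⟩
      · exact h
      · exact absurd (hw' k').2.2 (h1 ▸ hXN' x hx)
    have hpq' : ∀ b b', ((p, b) : Task n × Bool) ≠ (q, b') := by
      intro b b' h; exact hpq (Prod.ext_iff.1 h).1
    rintro e ⟨b, he⟩ ⟨b', he'⟩
    rcases he with rfl | rfl <;> rcases he' with he' | he'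
    · obtain ⟨h1, h2⟩ := hkey _ (hφm _) _ (hφm _) _ _ he'
      exact hwR _ _ (hpq' b b') ⟨Or.inl (hφ h1), h2⟩
    · obtain ⟨h1, h2⟩ := hkey _ (hφm _) _ (hZX _ (hzZ q)) _ _ he'
      exact hZφ _ _ (hzZ q) h1
    · obtain ⟨h1, h2⟩ := hkey _ (hZX _ (hzZ p)) _ (hφm _) _ _ he'
      exact hZφ _ _ (hzZ p) h1.symm
    · obtain ⟨h1, h2⟩ := hkey _ (hZX _ (hzZ p)) _ (hZX _ (hzZ q)) _ _ he'
      exact hwR _ _ (hpq' b b') ⟨Or.inr h1, h2⟩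
  · intro p
    have hz1 : ∀ b, Conn {e | ∃ b, e = s(φ (en (p, b)), w (p, b)) ∨ e = s(z p, w (p, b))}
        (φ (en (p, b))) (z p) := fun b =>
      Conn.trans (y := w (p, b)) (Conn.edge ⟨b, Or.inl rfl⟩)
        (Conn.symm (Conn.edge ⟨b, Or.inr rfl⟩))
    have h1 := hz1 true
    have h2 := hz1 false
    exact h1.trans h2.symm

theorem perfect_pairing (G : SimpleGraph V) (P : Finset V) (hP : Even P.card)
    (h : ∀ x ∈ P, 2 * (nb G x ∩ P).card < P.card) :
    ∃ P1 ⊆ P, ∃ g : V → V, Set.InjOn g P1 ∧ P1.image g = P \ P1 ∧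
      ∀ p ∈ P1, ¬ G.Adj p (g p) := by
  let Q : Finset V → Prop := fun P1 => P1 ⊆ P ∧ ∃ g : V → V, Set.InjOn g P1 ∧
    P1.image g ⊆ P \ P1 ∧ ∀ p ∈ P1, ¬ G.Adj p (g p)
  have hne : (Finset.univ.filter Q).Nonempty :=
    ⟨∅, by simp only [Finset.mem_filter, Finset.mem_univ, true_and, Q]; exact ⟨by simp, id, by simp, by simp, by simp⟩⟩
  obtain ⟨P1, hP1, hmax⟩ := Finset.exists_max_image (Finset.univ.filter Q) Finset.card hne
  obtain ⟨hsub, g, hg, him, hadj⟩ := (Finset.mem_filter.1 hP1).2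
  have hmax' : ∀ P2, Q P2 → P2.card ≤ P1.card := fun P2 h2 => hmax P2 (by simp [h2])
  refine ⟨P1, hsub, g, hg, ?_, hadj⟩
  refine Finset.Subset.antisymm him ?_
  by_contra hcon
  set M := P1.image g with hM
  have hMc : M.card = P1.card := Finset.card_image_of_injOn hg
  set U := (P \ P1) \ M with hU
  have hUc : U.card + 2 * P1.card = P.card := by
    have h1 : U.card + M.card = (P \ P1).card := Finset.card_sdiff_add_card_eq_card him
    have h2 := Finset.card_sdiff_add_card_eq_card hsub
    omega
  have hUne : U.Nonempty := Finset.sdiff_nonempty.2 hcon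
  have hU2 : 1 < U.card := by
    have := Finset.card_pos.2 hUne
    obtain ⟨r, hr⟩ := hP
    omega
  obtain ⟨x, hx, x', hx', hxx⟩ := Finset.one_lt_card.1 hU2
  have hUmem : ∀ y ∈ U, y ∈ P ∧ y ∉ P1 ∧ y ∉ M := by
    intro y hy; simp only [hU, Finset.mem_sdiff] at hy; tauto
  have hMP : ∀ p ∈ P1, g p ∈ P ∧ g p ∉ P1 := by
    intro p hp
    have := him (Finset.mem_image_of_mem g hp)
    simpa using this
  -- unmatched vertices are pairwise adjacent
  have hUadj : ∀ a ∈ U, ∀ b ∈ U, a ≠ b → G.Adj a b := by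
    intro a ha b hb hab
    by_contra hna
    have hga : ∀ p ∈ P1, p ≠ a := fun p hp h => (hUmem a ha).2.1 (h ▸ hp)
    have hq : Q (insert a P1) := by
      refine ⟨?_, Function.update g a b, ?_, ?_, ?_⟩
      · intro y hy
        rcases Finset.mem_insert.1 hy with rfl | hy
        · exact (hUmem _ ha).1
        · exact hsub hy
      · intro p hp q hq hpq
        simp only [Finset.coe_insert, Set.mem_insert_iff, Finset.mem_coe] at hp hq
        rcases hp with rfl | hp <;> rcases hq with rfl | hq
        · rfl
        · simp only [Function.update_self, Function.update_of_ne (hga q hq)] at hpq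
          exact absurd (Finset.mem_image_of_mem g hq) (hpq ▸ (hUmem b hb).2.2)
        · simp only [Function.update_self, Function.update_of_ne (hga p hp)] at hpq
          exact absurd (Finset.mem_image_of_mem g hp) (hpq ▸ (hUmem b hb).2.2)
        · simp only [Function.update_of_ne (hga p hp), Function.update_of_ne (hga q hq)] at hpq
          exact hg hp hq hpq
      · intro y hy
        obtain ⟨p, hp, rfl⟩ := Finset.mem_image.1 hy
        rcases Finset.mem_insert.1 hp with rfl | hp
        · simp only [Function.update_self, Finset.mem_sdiff, Finset.mem_insert, not_or]
          exact ⟨(hUmem b hb).1, fun h => hab h.symm, (hUmem b hb).2.1⟩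
        · simp only [Function.update_of_ne (hga p hp), Finset.mem_sdiff, Finset.mem_insert, not_or]
          refine ⟨(hMP p hp).1, ?_, (hMP p hp).2⟩
          intro h; exact (hUmem a ha).2.2 (h ▸ Finset.mem_image_of_mem g hp)
      · intro p hp
        rcases Finset.mem_insert.1 hp with rfl | hp
        · simpa using hna
        · simpa only [Function.update_of_ne (hga p hp)] using hadj p hp
    have := hmax' _ hq
    rw [Finset.card_insert_of_notMem (hUmem a ha).2.1] at this
    omega
  -- exchange
  have hex : ∀ a ∈ U, ∀ b ∈ U, a ≠ b → ∀ p ∈ P1, G.Adj a p ∨ G.Adj b (g p) := by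
    intro a ha b hb hab p hp
    by_contra hna
    push Not at hna
    -- new matching: p ↦ a, b ↦ g p
    have hga : ∀ p ∈ P1, p ≠ b := fun p hp h => (hUmem b hb).2.1 (h ▸ hp)
    let g' : V → V := Function.update (Function.update g b (g p)) p a
    have g'p : g' p = a := by simp [g']
    have g'b : g' b = g p := by simp [g', (hga p hp).symm]
    have g'o : ∀ q ∈ P1, q ≠ p → g' q = g q := by
      intro q hq hqp; simp [g', hqp, hga q hq]
    have hval : ∀ q ∈ insert b P1, (q = p ∧ g' q = a) ∨ (q = b ∧ g' q = g p) ∨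
        (q ∈ P1 ∧ q ≠ p ∧ g' q = g q) := by
      intro q hq
      rcases Finset.mem_insert.1 hq with rfl | hq
      · exact Or.inr (Or.inl ⟨rfl, g'b⟩)
      · by_cases hqp : q = p
        · subst hqp; exact Or.inl ⟨rfl, g'p⟩
        · exact Or.inr (Or.inr ⟨hq, hqp, g'o q hq hqp⟩)
    have haM : ∀ q ∈ P1, g q ≠ a := fun q hq h =>
      (hUmem a ha).2.2 (h ▸ Finset.mem_image_of_mem g hq)
    have hbM : ∀ q ∈ P1, g q ≠ b := fun q hq h =>
      (hUmem b hb).2.2 (h ▸ Finset.mem_image_of_mem g hq)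
    have hq : Q (insert b P1) := by
      refine ⟨?_, g', ?_, ?_, ?_⟩
      · intro y hy
        rcases Finset.mem_insert.1 hy with rfl | hy
        · exact (hUmem _ hb).1
        · exact hsub hy
      · intro q hq r hr hqr
        rcases hval q hq with ⟨rfl, h1⟩ | ⟨rfl, h1⟩ | ⟨h0, h00, h1⟩ <;>
          rcases hval r hr with ⟨rfl, h2⟩ | ⟨rfl, h2⟩ | ⟨h3, h30, h2⟩ <;>
          first | rfl | rw [h1, h2] at hqr
        · exact absurd hqr.symm (haM _ hp)
        · exact absurd hqr.symm (haM _ h3)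
        · exact absurd hqr (haM _ hp)
        · exact absurd (hg hp h3 hqr).symm h30
        · exact absurd hqr (haM _ h0)
        · exact absurd (hg h0 hp hqr) h00
        · exact hg h0 h3 hqr
      · intro y hy
        obtain ⟨q, hq, rfl⟩ := Finset.mem_image.1 hy
        rw [Finset.mem_sdiff, Finset.mem_insert, not_or]
        rcases hval q hq with ⟨rfl, h1⟩ | ⟨rfl, h1⟩ | ⟨h0, h00, h1⟩ <;> rw [h1]
        · exact ⟨(hUmem a ha).1, hab, (hUmem a ha).2.1⟩
        · exact ⟨(hMP p hp).1, hbM p hp, (hMP p hp).2⟩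
        · exact ⟨(hMP q h0).1, hbM q h0, (hMP q h0).2⟩
      · intro q hq
        rcases hval q hq with ⟨rfl, h1⟩ | ⟨rfl, h1⟩ | ⟨h0, h00, h1⟩ <;> rw [h1]
        · exact fun h => hna.1 h.symm
        · exact hna.2
        · exact hadj q h0
    have := hmax' _ hq
    rw [Finset.card_insert_of_notMem (hUmem b hb).2.1] at this
    omega
  -- counting
  have hcnt : ∀ a ∈ U, (P1.filter (fun p => G.Adj a p)).card +
      (P1.filter (fun p => G.Adj a (g p))).card + (U.card - 1) ≤ (nb G a ∩ P).card := by
    intro a ha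
    have hs : ((P1.filter (fun p => G.Adj a p)) ∪ (P1.filter (fun p => G.Adj a (g p))).image g) ∪
        U.erase a ⊆ nb G a ∩ P := by
      intro y hy
      simp only [Finset.mem_union, Finset.mem_filter, Finset.mem_image, Finset.mem_erase] at hy
      rw [Finset.mem_inter, mem_nb]
      rcases hy with (⟨h1, h2⟩ | ⟨p, ⟨hp, h1⟩, rfl⟩) | ⟨h1, h2⟩
      · exact ⟨h2, hsub h1⟩
      · exact ⟨h1, (hMP p hp).1⟩
      · exact ⟨hUadj a ha y h2 (Ne.symm h1), (hUmem y h2).1⟩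
    have h1 := Finset.card_le_card hs
    rw [Finset.card_union_of_disjoint, Finset.card_union_of_disjoint,
      Finset.card_image_of_injOn, Finset.card_erase_of_mem ha] at h1
    · exact h1
    · exact hg.mono (by intro y; simp; tauto)
    · rw [Finset.disjoint_left]
      intro y hy hy'
      simp only [Finset.mem_filter, Finset.mem_image] at hy hy'
      obtain ⟨p, ⟨hp, _⟩, rfl⟩ := hy'
      exact (hMP p hp).2 hy.1
    · rw [Finset.disjoint_left]
      intro y hy hy'
      have hy' := (Finset.mem_erase.1 hy').2
      simp only [Finset.mem_union, Finset.mem_filter, Finset.mem_image] at hy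
      rcases hy with hy | ⟨p, ⟨hp, _⟩, rfl⟩
      · exact (hUmem y hy').2.1 hy.1
      · exact (hUmem _ hy').2.2 (Finset.mem_image_of_mem g hp)
  have hor : ∀ a ∈ U, ∀ b ∈ U, a ≠ b → P1.card ≤ (P1.filter (fun p => G.Adj a p)).card +
      (P1.filter (fun p => G.Adj b (g p))).card := by
    intro a ha b hb hab
    have hs : P1 ⊆ (P1.filter (fun p => G.Adj a p)) ∪ (P1.filter (fun p => G.Adj b (g p))) := by
      intro p hp
      have := hex a ha b hb hab p hp
      simp only [Finset.mem_union, Finset.mem_filter]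
      tauto
    exact (Finset.card_le_card hs).trans (Finset.card_union_le _ _)
  have h1 := hor x hx x' hx' hxx
  have h2 := hor x' hx' x hx hxx.symm
  have h3 := hcnt x hx
  have h4 := hcnt x' hx'
  have h5 := h x (hUmem x hx).1
  have h6 := h x' (hUmem x' hx').1
  omega

end TOI

end

section

namespace TOI
open SimpleGraph
open scoped Classical
set_option linter.unusedSectionVars false
set_option linter.unusedVariables false
variable {V : Type*} [Fintype V]

/-- paired by g on P -/
def Prd (P : Finset V) (g : V → V) (x y : V) : Prop := (x ∈ P ∧ y = g x) ∨ (y ∈ P ∧ x = g y)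

theorem Prd.symm {P : Finset V} {g : V → V} {x y : V} (h : Prd P g x y) : Prd P g y x := by
  unfold Prd at *; tauto

theorem imm_pairs {H H' : SimpleGraph V} {a : V} {P : Finset V} {g : V → V}
    (hg : Set.InjOn g P) (hd : ∀ p ∈ P, g p ∉ P) (h1 : ∀ p ∈ P, H.Adj a p)
    (h2 : ∀ p ∈ P, H.Adj a (g p))
    (hH : ∀ x y, H'.Adj x y → (H.Adj x y ∧ (x = a → y ∉ P ∧ y ∉ P.image g) ∧
      (y = a → x ∉ P ∧ x ∉ P.image g)) ∨ (x ≠ a ∧ y ≠ a ∧ Prd P g x y)) : Imm H H' := by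
  have hsplit : ∀ e ∈ H'.edgeSet, e ∉ H.edgeSet → ∃ p ∈ P, e = s(p, g p) := by
    intro e he he'
    induction e using Sym2.ind with
    | _ x y =>
      rcases hH x y he with h | ⟨_, _, h | h⟩
      · exact absurd h.1 he'
      · exact ⟨x, h.1, by rw [h.2]⟩
      · exact ⟨y, h.1, by rw [h.2, Sym2.eq_swap]⟩
  have hkeep : ∀ u, H'.Adj a u → u ∉ P ∧ u ∉ P.image g := by
    intro u hu
    rcases hH a u hu with h | h
    · exact h.2.1 rfl
    · exact absurd rfl h.1
  refine ⟨fun e => if e ∈ H.edgeSet then {e} else {f | ∃ x ∈ e, f = s(a, x)}, ?_, ?_, ?_⟩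
  · intro e he
    by_cases heH : e ∈ H.edgeSet
    · simpa [heH] using heH
    · obtain ⟨p, hp, rfl⟩ := hsplit e he heH
      simp only [heH, if_false]
      rintro f ⟨x, hx, rfl⟩
      rcases Sym2.mem_iff.1 hx with rfl | rfl
      · exact h1 _ hp
      · exact h2 p hp
  · have aux : ∀ e ∈ H'.edgeSet, ∀ p ∈ P, ∀ x ∈ s(p, g p), e ≠ s(a, x) := by
      rintro e he p hp x hx rfl
      have := hkeep x he
      rcases Sym2.mem_iff.1 hx with rfl | rfl
      · exact this.1 hp
      · exact this.2 (Finset.mem_image_of_mem g hp)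
    intro e he f hf hne
    by_cases heH : e ∈ H.edgeSet <;> by_cases hfH : f ∈ H.edgeSet
    · simpa [heH, hfH] using hne
    · obtain ⟨p, hp, rfl⟩ := hsplit f hf hfH
      simp only [heH, hfH, if_true, if_false, Set.disjoint_singleton_left]
      rintro ⟨x, hx, hx'⟩
      exact aux e he p hp x hx hx'
    · obtain ⟨p, hp, rfl⟩ := hsplit e he heH
      simp only [heH, hfH, if_true, if_false, Set.disjoint_singleton_right]
      rintro ⟨x, hx, hx'⟩
      exact aux f hf p hp x hx hx'
    · obtain ⟨p, hp, rfl⟩ := hsplit e he heH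
      obtain ⟨q, hq, rfl⟩ := hsplit f hf hfH
      simp only [heH, hfH, if_false]
      rw [Set.disjoint_left]
      rintro f ⟨x, hx, rfl⟩ ⟨y, hy, hxy⟩
      have hxy' : x = y := by
        rw [Sym2.eq_iff] at hxy
        rcases hxy with h | h
        · exact h.2
        · rw [h.2, ← h.1]
      subst hxy'
      have hpq : p ≠ q := fun h => hne (by rw [h])
      rcases Sym2.mem_iff.1 hx with hx | hx <;> rcases Sym2.mem_iff.1 hy with hy | hy
      · exact hpq (hx.symm.trans hy)
      · exact hd q hq (by rw [← hy, hx]; exact hp)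
      · exact hd p hp (by rw [← hx, hy]; exact hq)
      · exact hpq (hg hp hq (hx.symm.trans hy))
  · intro x y hxy
    by_cases hH' : s(x, y) ∈ H.edgeSet
    · simp only [hH', if_true]
      exact Conn.edge rfl
    · simp only [hH', if_false]
      refine Conn.trans (y := a) (Conn.symm (Conn.edge ⟨x, by simp, rfl⟩))
        (Conn.edge ⟨y, by simp, rfl⟩)

/-- hypotheses of a star split -/
structure SSD (H : SimpleGraph V) (a : V) (P : Finset V) (g : V → V) : Prop where
  inj : Set.InjOn g P
  dis : ∀ p ∈ P, g p ∉ P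
  adj1 : ∀ p ∈ P, H.Adj a p
  adj2 : ∀ p ∈ P, H.Adj a (g p)
  non : ∀ p ∈ P, ¬ H.Adj p (g p)

/-- star split -/
def SS (H : SimpleGraph V) (a : V) (P : Finset V) (g : V → V) : SimpleGraph V where
  Adj x y := (H.Adj x y ∧ (x = a → y ∉ P ∧ y ∉ P.image g) ∧
      (y = a → x ∉ P ∧ x ∉ P.image g)) ∨ (x ≠ a ∧ y ≠ a ∧ x ≠ y ∧ Prd P g x y)
  symm := ⟨by
    intro x y h
    rcases h with ⟨h1, h2, h3⟩ | ⟨h1, h2, h3, h4⟩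
    · exact Or.inl ⟨h1.symm, h3, h2⟩
    · exact Or.inr ⟨h2, h1, h3.symm, h4.symm⟩⟩
  loopless := ⟨by
    intro x h
    rcases h with ⟨h1, _⟩ | ⟨_, _, h3, _⟩
    · exact H.irrefl h1
    · exact h3 rfl⟩

theorem ss_imm {H : SimpleGraph V} {a : V} {P : Finset V} {g : V → V} (h : SSD H a P g) :
    Imm H (SS H a P g) := by
  refine imm_pairs h.inj h.dis h.adj1 h.adj2 ?_
  intro x y hxy
  rcases hxy with hxy | hxy
  · exact Or.inl hxy
  · exact Or.inr ⟨hxy.1, hxy.2.1, hxy.2.2.2⟩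

theorem ss_nb_a {H : SimpleGraph V} {a : V} {P : Finset V} {g : V → V} (h : SSD H a P g) :
    nb (SS H a P g) a = nb H a \ (P ∪ P.image g) := by
  ext y
  have : y = a → ¬ H.Adj a y := by rintro rfl; exact H.irrefl
  simp only [mem_nb, SS, Finset.mem_sdiff, Finset.mem_union]
  tauto

theorem ss_dg_a {H : SimpleGraph V} {a : V} {P : Finset V} {g : V → V} (h : SSD H a P g) :
    dg (SS H a P g) a + 2 * P.card = dg H a := by
  unfold dg
  rw [ss_nb_a h]
  have hs : P ∪ P.image g ⊆ nb H a := by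
    intro y hy
    rcases Finset.mem_union.1 hy with hy | hy
    · simpa using h.adj1 y hy
    · obtain ⟨p, hp, rfl⟩ := Finset.mem_image.1 hy
      simpa using h.adj2 p hp
  have h1 := Finset.card_sdiff_add_card_eq_card hs
  rw [Finset.card_union_of_disjoint, Finset.card_image_of_injOn h.inj] at h1
  · omega
  · rw [Finset.disjoint_left]
    intro y hy hy'
    obtain ⟨p, hp, rfl⟩ := Finset.mem_image.1 hy'
    exact h.dis p hp hy

theorem ss_adj {H : SimpleGraph V} {a : V} {P : Finset V} {g : V → V} (h : SSD H a P g)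
    {x y : V} (hx : x ≠ a) (hy : y ≠ a) :
    (SS H a P g).Adj x y ↔ H.Adj x y ∨ Prd P g x y := by
  have hne : Prd P g x y → x ≠ y := by
    rintro h' rfl
    rcases h' with ⟨h1, h2⟩ | ⟨h1, h2⟩ <;> exact h.dis x h1 (h2 ▸ h1)
  simp only [SS]
  tauto

theorem ss_adj_a {H : SimpleGraph V} {a : V} {P : Finset V} {g : V → V} (h : SSD H a P g)
    {y : V} : (SS H a P g).Adj a y ↔ H.Adj a y ∧ y ∉ P ∧ y ∉ P.image g := by
  have := ss_nb_a h
  have h2 : y ∈ nb (SS H a P g) a ↔ y ∈ nb H a \ (P ∪ P.image g) := by rw [this]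
  simpa [not_or] using h2

theorem ss_nb_other {H : SimpleGraph V} {a : V} {P : Finset V} {g : V → V} (h : SSD H a P g)
    {x : V} (hx : x ≠ a) (hxP : x ∉ P) (hxg : x ∉ P.image g) :
    nb (SS H a P g) x = nb H x := by
  ext y
  simp only [mem_nb]
  by_cases hy : y = a
  · subst hy
    rw [SimpleGraph.adj_comm, ss_adj_a h, SimpleGraph.adj_comm]; tauto
  · rw [ss_adj h hx hy]
    unfold Prd
    constructor
    · rintro (h | h | h)
      · exact h
      · exact absurd h.1 hxP
      · exact absurd (h.2 ▸ Finset.mem_image_of_mem g h.1) hxg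
    · exact Or.inl

theorem dg_swap {H : SimpleGraph V} {x a b : V} (ha : H.Adj x a) (hb : ¬ H.Adj x b) :
    (insert b ((nb H x).erase a)).card = dg H x := by
  rw [Finset.card_insert_of_notMem (by simp [hb]), Finset.card_erase_of_mem (by simpa using ha)]
  have : 0 < (nb H x).card := Finset.card_pos.2 ⟨a, by simpa using ha⟩
  unfold dg; omega

theorem ss_dg {H : SimpleGraph V} {a : V} {P : Finset V} {g : V → V} (h : SSD H a P g)
    {x : V} (hx : x ≠ a) : dg (SS H a P g) x = dg H x := by
  by_cases hxP : x ∈ P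
  · have : nb (SS H a P g) x = insert (g x) ((nb H x).erase a) := by
      ext y
      simp only [mem_nb, Finset.mem_insert, Finset.mem_erase]
      by_cases hy : y = a
      · subst hy
        have := (h.adj2 x hxP).ne
        rw [SimpleGraph.adj_comm, ss_adj_a h]
        tauto
      · rw [ss_adj h hx hy]
        unfold Prd
        constructor
        · rintro (h' | h' | h')
          · exact Or.inr ⟨hy, h'⟩
          · exact Or.inl h'.2
          · exact absurd (h'.2 ▸ hxP) (h.dis y h'.1)
        · rintro (h' | h')
          · exact Or.inr (Or.inl ⟨hxP, h'⟩)
          · exact Or.inl h'.2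
    unfold dg
    rw [this]
    exact dg_swap (h.adj1 x hxP).symm (h.non x hxP)
  by_cases hxg : x ∈ P.image g
  · obtain ⟨p, hp, rfl⟩ := Finset.mem_image.1 hxg
    have : nb (SS H a P g) (g p) = insert p ((nb H (g p)).erase a) := by
      ext y
      simp only [mem_nb, Finset.mem_insert, Finset.mem_erase]
      by_cases hy : y = a
      · subst hy
        have := (h.adj1 p hp).ne
        rw [SimpleGraph.adj_comm, ss_adj_a h]
        tauto
      · rw [ss_adj h hx hy]
        unfold Prd
        constructor
        · rintro (h' | h' | h')
          · exact Or.inr ⟨hy, h'⟩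
          · exact absurd h'.1 hxP
          · exact Or.inl (h.inj h'.1 hp h'.2.symm)
        · rintro (h' | h')
          · exact Or.inr (Or.inr ⟨h' ▸ hp, by rw [h']⟩)
          · exact Or.inl h'.2
    unfold dg
    rw [this]
    exact dg_swap (h.adj2 p hp).symm (fun h' => h.non p hp h'.symm)
  · unfold dg; rw [ss_nb_other h hx hxP hxg]

/-- replace the path x a c y by the edge x y -/
def S2 (H : SimpleGraph V) (x a c y : V) : SimpleGraph V :=
  fromEdgeSet ((H.edgeSet \ {s(x, a), s(a, c), s(c, y)}) ∪ {s(x, y)})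

/-- hypotheses of a path split -/
structure S2D (H : SimpleGraph V) (x a c y : V) : Prop where
  xa : H.Adj x a
  ac : H.Adj a c
  cy : H.Adj c y
  xy : ¬ H.Adj x y
  nxy : x ≠ y
  nxc : x ≠ c
  nya : y ≠ a

theorem s2_adj {H : SimpleGraph V} {x a c y : V} (h : S2D H x a c y) {u v : V} :
    (S2 H x a c y).Adj u v ↔ (H.Adj u v ∧ s(u, v) ≠ s(x, a) ∧ s(u, v) ≠ s(a, c) ∧
      s(u, v) ≠ s(c, y)) ∨ s(u, v) = s(x, y) := by
  simp only [S2, fromEdgeSet_adj, Set.mem_union, Set.mem_sdiff, Set.mem_insert_iff,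
    Set.mem_singleton_iff, not_or, mem_edgeSet]
  constructor
  · rintro ⟨h1 | h1, h2⟩
    · exact Or.inl h1
    · exact Or.inr h1
  · rintro (h1 | h1)
    · exact ⟨Or.inl h1, h1.1.ne⟩
    · refine ⟨Or.inr h1, ?_⟩
      rintro rfl
      rw [Sym2.eq_iff] at h1
      have := h.nxy
      rcases h1 with h1 | h1 <;> exact this (by rw [← h1.1, ← h1.2])

theorem s2_imm {H : SimpleGraph V} {x a c y : V} (h : S2D H x a c y) :
    Imm H (S2 H x a c y) := by
  have hE : ∀ e ∈ (S2 H x a c y).edgeSet, (e ∈ H.edgeSet ∧ e ≠ s(x, a) ∧ e ≠ s(a, c) ∧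
      e ≠ s(c, y)) ∨ e = s(x, y) := by
    intro e he
    induction e using Sym2.ind with
    | _ u v => exact (s2_adj h).1 he
  refine ⟨fun e => if e = s(x, y) then {s(x, a), s(a, c), s(c, y)} else {e}, ?_, ?_, ?_⟩
  · intro e he
    rcases hE e he with h1 | rfl
    · have : e ≠ s(x, y) := by rintro rfl; exact h.xy h1.1
      simpa [this] using h1.1
    · simp only [if_true]
      rintro f (rfl | rfl | rfl)
      · exact h.xa
      · exact h.ac
      · exact h.cy
  · intro e he f hf hne
    by_cases h1 : e = s(x, y) <;> by_cases h2 : f = s(x, y)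
    · exact absurd (h1.trans h2.symm) hne
    · rcases hE f hf with h3 | h3
      · simp only [h1, h2, if_true, if_false]
        simp only [Set.disjoint_singleton_right, Set.mem_insert_iff, Set.mem_singleton_iff]
        tauto
      · exact absurd h3 h2
    · rcases hE e he with h3 | h3
      · simp only [h1, h2, if_true, if_false]
        simp only [Set.disjoint_singleton_left, Set.mem_insert_iff, Set.mem_singleton_iff]
        tauto
      · exact absurd h3 h1
    · simpa [h1, h2] using hne
  · intro u v huv
    by_cases h1 : s(u, v) = s(x, y)
    · simp only [h1, if_true]
      have hc : Conn {s(x, a), s(a, c), s(c, y)} x y :=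
        (Conn.edge (by simp : s(x, a) ∈ ({s(x, a), s(a, c), s(c, y)} : Set (Sym2 V)))).trans
        ((Conn.edge (by simp)).trans (Conn.edge (by simp : s(c, y) ∈ _)))
      rw [Sym2.eq_iff] at h1
      rcases h1 with ⟨rfl, rfl⟩ | ⟨rfl, rfl⟩
      · exact hc
      · exact hc.symm
    · simp only [h1, if_false]
      exact Conn.edge rfl

theorem s2_dg_other {H : SimpleGraph V} {x a c y : V} (h : S2D H x a c y) {z : V}
    (hza : z ≠ a) (hzc : z ≠ c) : dg (S2 H x a c y) z = dg H z := by
  have n1 := h.xa.ne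
  have n2 := h.ac.ne
  have n3 := h.cy.ne
  have n4 := h.nxy
  have n5 := h.nxc
  have n6 := h.nya
  by_cases hzx : z = x
  · subst hzx
    have : nb (S2 H z a c y) z = insert y ((nb H z).erase a) := by
      ext w
      simp only [mem_nb, Finset.mem_insert, Finset.mem_erase, s2_adj h, Sym2.eq_iff]
      grind
    unfold dg; rw [this]; exact dg_swap h.xa h.xy
  by_cases hzy : z = y
  · subst hzy
    have : nb (S2 H x a c z) z = insert x ((nb H z).erase c) := by
      ext w
      simp only [mem_nb, Finset.mem_insert, Finset.mem_erase, s2_adj h, Sym2.eq_iff]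
      grind
    unfold dg; rw [this]; exact dg_swap h.cy.symm (fun h' => h.xy h'.symm)
  have : nb (S2 H x a c y) z = nb H z := by
    ext w
    simp only [mem_nb, s2_adj h, Sym2.eq_iff]
    grind
  unfold dg; rw [this]

theorem s2_nb_a {H : SimpleGraph V} {x a c y : V} (h : S2D H x a c y) :
    nb (S2 H x a c y) a = ((nb H a).erase x).erase c := by
  have n1 := h.xa.ne
  have n2 := h.ac.ne
  have n3 := h.cy.ne
  have n4 := h.nxy
  have n5 := h.nxc
  have n6 := h.nya
  ext w
  simp only [mem_nb, Finset.mem_erase, s2_adj h, Sym2.eq_iff]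
  grind

theorem s2_nb_c {H : SimpleGraph V} {x a c y : V} (h : S2D H x a c y) :
    nb (S2 H x a c y) c = ((nb H c).erase y).erase a := by
  have n1 := h.xa.ne
  have n2 := h.ac.ne
  have n3 := h.cy.ne
  have n4 := h.nxy
  have n5 := h.nxc
  have n6 := h.nya
  ext w
  simp only [mem_nb, Finset.mem_erase, s2_adj h, Sym2.eq_iff]
  grind

end TOI

end

section

namespace TOI
open SimpleGraph
open scoped Classical
set_option linter.unusedSectionVars false
set_option linter.unusedVariables false
variable {V : Type*} [Fintype V]

theorem dg_eq_degree (H : SimpleGraph V) (v : V) : dg H v = H.degree v := by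
  unfold dg
  rw [← card_neighborFinset_eq_degree]
  congr 1
  ext y; simp

theorem sum_symmDiff_zmod {α : Type*} [DecidableEq α] (T1 T2 : Finset α) (f : α → ZMod 2) :
    ∑ e ∈ symmDiff T1 T2, f e = ∑ e ∈ T1, f e + ∑ e ∈ T2, f e := by
  have h0 : symmDiff T1 T2 = (T1 \ T2) ∪ (T2 \ T1) := rfl
  rw [h0, Finset.sum_union (by
    rw [Finset.disjoint_left]; intro x; simp; tauto)]
  have h1 := Finset.sum_inter_add_sum_sdiff T1 T2 f
  have h2 := Finset.sum_inter_add_sum_sdiff T2 T1 f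
  rw [← h1, ← h2, Finset.inter_comm T2 T1]
  have h3 : ∀ x : ZMod 2, x + x = 0 := by decide
  have h4 := h3 (∑ x ∈ T1 ∩ T2, f x)
  linear_combination (-1 : ZMod 2) * h4

theorem dg_fromEdge (G : SimpleGraph V) (T : Finset (Sym2 V)) (hT : T ⊆ G.edgeFinset) (v : V) :
    dg (fromEdgeSet (T : Set (Sym2 V))) v = (T.filter (fun e => v ∈ e)).card := by
  have hE : (fromEdgeSet (T : Set (Sym2 V))).edgeFinset = T := by
    ext e
    simp only [mem_edgeFinset, edgeSet_fromEdgeSet, Set.mem_sdiff, Finset.mem_coe]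
    constructor
    · exact fun h => h.1
    · intro h
      refine ⟨h, ?_⟩
      have := hT h
      rw [mem_edgeFinset] at this
      exact G.not_isDiag_of_mem_edgeSet this
  rw [dg_eq_degree, ← card_incidenceFinset_eq_degree, incidenceFinset_eq_filter, hE]

theorem sum_dg (H : SimpleGraph V) [Fintype H.edgeSet] : ∑ v, dg H v = 2 * H.edgeFinset.card := by
  have h := sum_degrees_eq_twice_card_edges H
  have h2 : ∑ v, dg H v = ∑ v, H.degree v := Finset.sum_congr rfl (fun v _ => dg_eq_degree H v)
  rw [h2, h]
  congr!

theorem exists_even (G : SimpleGraph V) : ∃ H ≤ G, (∀ v, Even (dg H v)) ∧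
    ∑ v, dg G v ≤ ∑ v, dg H v + 2 * Fintype.card V := by
  let par : Finset (Sym2 V) → V → ZMod 2 := fun T v => ∑ e ∈ T, if v ∈ e then 1 else 0
  have hpar : ∀ T ⊆ G.edgeFinset, par T = 0 →
      ∀ v, Even (dg (fromEdgeSet (T : Set (Sym2 V))) v) := by
    intro T hT h v
    have h1 := congrFun h v
    rw [dg_fromEdge G T hT, ← ZMod.natCast_eq_zero_iff_even]
    simpa [par] using h1
  obtain ⟨T, hT, hmax⟩ := Finset.exists_max_image
    (G.edgeFinset.powerset.filter (fun T => par T = 0)) Finset.card ⟨∅, by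
      simp only [Finset.mem_filter, Finset.empty_mem_powerset, true_and]
      funext v; simp [par]⟩
  rw [Finset.mem_filter, Finset.mem_powerset] at hT
  obtain ⟨hTG, hT0⟩ := hT
  have hle : (G.edgeFinset \ T).card ≤ Fintype.card V := by
    by_contra hcon
    push Not at hcon
    have hpig : ∃ T1 ∈ (G.edgeFinset \ T).powerset, ∃ T2 ∈ (G.edgeFinset \ T).powerset,
        T1 ≠ T2 ∧ par T1 = par T2 := by
      apply Finset.exists_ne_map_eq_of_card_lt_of_maps_to (t := (Finset.univ : Finset (V → ZMod 2)))
      · rw [Finset.card_powerset, Finset.card_univ, Fintype.card_fun, ZMod.card]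
        exact Nat.pow_lt_pow_right (by norm_num) hcon
      · intro _ _; simp
    obtain ⟨T1, hT1, T2, hT2, hne, heq⟩ := hpig
    rw [Finset.mem_powerset] at hT1 hT2
    set D := symmDiff T1 T2 with hD
    have hDsub : D ⊆ G.edgeFinset \ T := by
      intro e he
      rw [hD, Finset.mem_symmDiff] at he
      rcases he with h | h
      · exact hT1 h.1
      · exact hT2 h.1
    have hDne : D.Nonempty := by
      rw [Finset.nonempty_iff_ne_empty]
      intro h
      exact hne (symmDiff_eq_bot.1 h)
    have hdisj : Disjoint T D := by
      rw [Finset.disjoint_left]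
      intro e he he'
      exact (Finset.mem_sdiff.1 (hDsub he')).2 he
    have hm := hmax (T ∪ D) (by
      rw [Finset.mem_filter, Finset.mem_powerset]
      refine ⟨Finset.union_subset hTG (hDsub.trans Finset.sdiff_subset), ?_⟩
      funext v
      have h1 := congrFun hT0 v
      have h2 := congrFun heq v
      simp only [par, Pi.zero_apply] at h1 h2 ⊢
      rw [Finset.sum_union hdisj, hD, sum_symmDiff_zmod, h1, h2, zero_add]
      have h3 : ∀ x : ZMod 2, x + x = 0 := by decide
      exact h3 _)
    rw [Finset.card_union_of_disjoint hdisj] at hm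
    have := Finset.card_pos.2 hDne
    omega
  refine ⟨fromEdgeSet (T : Set (Sym2 V)), ?_, hpar T hTG hT0, ?_⟩
  · intro x y hxy
    rw [fromEdgeSet_adj] at hxy
    have := hTG hxy.1
    rwa [mem_edgeFinset] at this
  · rw [sum_dg, sum_dg]
    have hE : (fromEdgeSet (T : Set (Sym2 V))).edgeFinset = T := by
      ext e
      simp only [mem_edgeFinset, edgeSet_fromEdgeSet, Set.mem_sdiff, Finset.mem_coe]
      constructor
      · exact fun h => h.1
      · intro h
        refine ⟨h, ?_⟩
        have := hTG h
        rw [mem_edgeFinset] at this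
        exact G.not_isDiag_of_mem_edgeSet this
    rw [hE]
    have := Finset.card_sdiff_add_card_eq_card hTG
    omega

/-- toggled vertex deletion -/
def Tog (H : SimpleGraph V) (v : V) (P : Finset V) (g : V → V) : SimpleGraph V where
  Adj x y := x ≠ v ∧ y ≠ v ∧ x ≠ y ∧ ((H.Adj x y ∧ ¬ Prd P g x y) ∨ (¬ H.Adj x y ∧ Prd P g x y))
  symm := ⟨by
    intro x y h
    have e1 := H.adj_comm x y
    have e2 : Prd P g x y ↔ Prd P g y x := ⟨Prd.symm, Prd.symm⟩
    have := h.2.2.1.symm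
    tauto⟩
  loopless := ⟨fun x h => h.2.2.1 rfl⟩

theorem delete_vertex (H : SimpleGraph V) (v : V) (hev : ∀ x, Even (dg H x)) :
    ∃ H', Imm H H' ∧ (∀ x, Even (dg H' x)) ∧ dg H' v = 0 ∧ (∀ x, dg H' x ≤ dg H x) ∧
      (∀ x, x ≠ v → dg H x ≤ dg H' x + if H.Adj v x then 2 else 0) := by
  obtain ⟨P, hPs, g, hg, him, -⟩ := perfect_pairing (⊥ : SimpleGraph V) (nb H v) (hev v) (by
    intro x hx
    have : nb (⊥ : SimpleGraph V) x ∩ nb H v = ∅ := by ext; simp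
    rw [this]
    simpa using Finset.card_pos.2 ⟨x, hx⟩)
  have hgm : ∀ p ∈ P, H.Adj v (g p) ∧ g p ∉ P := by
    intro p hp
    have : g p ∈ nb H v \ P := him ▸ Finset.mem_image_of_mem g hp
    simpa using this
  have hPm : ∀ p ∈ P, H.Adj v p := fun p hp => by simpa using hPs hp
  have hself : nb (Tog H v P g) v = ∅ := by ext y; simp [Tog]
  have hout : ∀ x, x ≠ v → ¬ H.Adj v x → nb (Tog H v P g) x = nb H x := by
    intro x hx hvx
    have hnp : ∀ y, ¬ Prd P g x y := by
      rintro y (⟨h1, h2⟩ | ⟨h1, h2⟩)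
      · exact hvx (hPm x h1)
      · exact hvx (h2 ▸ (hgm y h1).1)
    ext y
    simp only [mem_nb, Tog]
    constructor
    · rintro ⟨_, _, _, h | h⟩
      · exact h.1
      · exact absurd h.2 (hnp y)
    · intro h
      exact ⟨hx, fun h' => hvx (h' ▸ h.symm), h.ne, Or.inl ⟨h, hnp y⟩⟩
  have hin : ∀ x, H.Adj v x → ∃ q, q ≠ x ∧ q ≠ v ∧ ∀ y, Prd P g x y ↔ y = q := by
    intro x hx
    by_cases hxP : x ∈ P
    · refine ⟨g x, fun h => (hgm x hxP).2 (h.symm ▸ hxP), (hgm x hxP).1.ne', ?_⟩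
      intro y
      constructor
      · rintro (⟨h1, h2⟩ | ⟨h1, h2⟩)
        · exact h2
        · exact absurd (h2 ▸ hxP) (hgm y h1).2
      · intro h; exact Or.inl ⟨hxP, h⟩
    · have : x ∈ P.image g := by rw [him]; simp [hx, hxP]
      obtain ⟨p, hp, rfl⟩ := Finset.mem_image.1 this
      refine ⟨p, fun h => hxP (h ▸ hp), (hPm p hp).ne', ?_⟩
      intro y
      constructor
      · rintro (⟨h1, h2⟩ | ⟨h1, h2⟩)
        · exact absurd h1 hxP
        · exact (hg hp h1 h2).symm
      · rintro rfl; exact Or.inr ⟨hp, rfl⟩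
  have hindg : ∀ x, H.Adj v x → dg (Tog H v P g) x = dg H x ∨ dg (Tog H v P g) x + 2 = dg H x := by
    intro x hx
    obtain ⟨q, hqx, hqv, hq⟩ := hin x hx
    by_cases hxq : H.Adj x q
    · right
      have : nb (Tog H v P g) x = ((nb H x).erase v).erase q := by
        ext y
        simp only [mem_nb, Tog, Finset.mem_erase, hq]
        have := hx.ne'
        have h3 : H.Adj x y → x ≠ y := fun h => h.ne
        constructor
        · rintro ⟨_, h1, _, h | h⟩
          · exact ⟨h.2, h1, h.1⟩
          · exact absurd (h.2 ▸ hxq) h.1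
        · rintro ⟨h1, h2, h4⟩
          exact ⟨this, h2, h3 h4, Or.inl ⟨h4, h1⟩⟩
      unfold dg
      rw [this, Finset.card_erase_of_mem (by simp [hqv, hxq]),
        Finset.card_erase_of_mem (by simpa using hx.symm)]
      have h2 : 1 < (nb H x).card :=
        Finset.one_lt_card.2 ⟨v, by simpa using hx.symm, q, by simpa using hxq, hqv.symm⟩
      omega
    · left
      have : nb (Tog H v P g) x = insert q ((nb H x).erase v) := by
        ext y
        simp only [mem_nb, Tog, Finset.mem_erase, hq, Finset.mem_insert]
        have := hx.ne'
        have h3 : H.Adj x y → x ≠ y := fun h => h.ne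
        constructor
        · rintro ⟨_, h1, _, h | h⟩
          · exact Or.inr ⟨h1, h.1⟩
          · exact Or.inl h.2
        · rintro (rfl | ⟨h1, h2⟩)
          · exact ⟨this, hqv, hqx.symm, Or.inr ⟨hxq, rfl⟩⟩
          · exact ⟨this, h1, h3 h2, Or.inl ⟨h2, fun h => hxq (h ▸ h2)⟩⟩
      unfold dg
      rw [this]
      exact dg_swap hx.symm hxq
  refine ⟨Tog H v P g, ?_, ?_, ?_, ?_, ?_⟩
  · refine imm_pairs (a := v) hg (fun p hp => (hgm p hp).2) hPm (fun p hp => (hgm p hp).1) ?_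
    rintro x y ⟨h1, h2, h3, h4 | h4⟩
    · exact Or.inl ⟨h4.1, fun h => absurd h h1, fun h => absurd h h2⟩
    · exact Or.inr ⟨h1, h2, h4.2⟩
  · intro x
    by_cases hxv : x = v
    · subst hxv; unfold dg; rw [hself]; simp
    by_cases hx : H.Adj v x
    · have := hev x
      rcases hindg x hx with h | h
      · rwa [h]
      · rw [← h] at this
        rw [Nat.even_add] at this
        exact this.2 (by norm_num)
    · unfold dg; rw [hout x hxv hx]; exact hev x
  · unfold dg; rw [hself]; simp
  · intro x
    by_cases hxv : x = v
    · subst hxv; unfold dg; rw [hself]; simp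
    by_cases hx : H.Adj v x
    · rcases hindg x hx with h | h <;> omega
    · unfold dg; rw [hout x hxv hx]
  · intro x hxv
    by_cases hx : H.Adj v x
    · simp only [hx, if_true]
      rcases hindg x hx with h | h <;> omega
    · simp only [hx, if_false]
      unfold dg; rw [hout x hxv hx]; simp

theorem exists_mindeg (G : SimpleGraph V) [Nonempty V] {d : ℕ} (hd : 0 < d)
    (hG : ∀ v, 3 * d + 2 ≤ dg G v) :
    ∃ H, Imm G H ∧ ∃ A : Finset V, A.Nonempty ∧ (∀ x, Even (dg H x)) ∧ (∀ x ∉ A, dg H x = 0) ∧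
      ∀ x ∈ A, d ≤ dg H x := by
  let Q : Finset V → Prop := fun A => A.Nonempty ∧ ∃ H, Imm G H ∧ (∀ x, Even (dg H x)) ∧
    (∀ x ∉ A, dg H x = 0) ∧ 3 * d * A.card ≤ ∑ x ∈ A, dg H x
  have hQ : (Finset.univ.filter Q).Nonempty := by
    refine ⟨Finset.univ, ?_⟩
    rw [Finset.mem_filter]
    refine ⟨Finset.mem_univ _, Finset.univ_nonempty, ?_⟩
    obtain ⟨H, hH, hev, hsum⟩ := exists_even G
    refine ⟨H, Imm.of_le hH, hev, by simp, ?_⟩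
    have h1 : ∑ v : V, (3 * d + 2) ≤ ∑ v, dg G v := Finset.sum_le_sum (fun v _ => hG v)
    simp only [Finset.sum_const, Finset.card_univ, smul_eq_mul] at h1 ⊢
    nlinarith
  obtain ⟨A, hA, hmin⟩ := Finset.exists_min_image (Finset.univ.filter Q) Finset.card hQ
  obtain ⟨hAne, H, hI, hev, h0, hsum⟩ := (Finset.mem_filter.1 hA).2
  refine ⟨H, hI, A, hAne, hev, h0, ?_⟩
  intro v hv
  by_contra hlt
  push Not at hlt
  have hnbA : nb H v ⊆ A := by
    intro x hx
    by_contra hxA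
    have h1 := h0 x hxA
    have : v ∈ nb H x := by simpa using (mem_nb.1 hx).symm
    rw [dg, Finset.card_eq_zero] at h1
    rw [h1] at this; simp at this
  obtain ⟨H', hI', hev', hv0, hle, hge⟩ := delete_vertex H v hev
  have hQ' : Q (A.erase v) := by
    have hsum' : ∑ x ∈ A, dg H x = ∑ x ∈ A.erase v, dg H x + dg H v :=
      (Finset.sum_erase_add A (dg H) hv).symm
    have hcard := Finset.card_erase_add_one hv
    have hAe : (A.erase v).Nonempty := by
      rw [Finset.nonempty_iff_ne_empty]
      intro he
      rw [he] at hcard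
      have : nb H v = ∅ := by
        rw [Finset.eq_empty_iff_forall_notMem]
        intro x hx
        have h1 : x ∈ A.erase v := by
          rw [Finset.mem_erase]
          exact ⟨(mem_nb.1 hx).ne', hnbA hx⟩
        rw [he] at h1; simp at h1
      have h2 : dg H v = 0 := by unfold dg; rw [this]; simp
      rw [he, Finset.sum_empty, h2] at hsum'
      rw [hsum', ← hcard] at hsum
      simp at hsum
      omega
    refine ⟨hAe, H', hI.trans hI', hev', ?_, ?_⟩
    · intro x hx
      by_cases hxv : x = v
      · rw [hxv]; exact hv0
      · have : x ∉ A := fun h => hx (Finset.mem_erase.2 ⟨hxv, h⟩)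
        have := h0 x this
        have := hle x
        omega
    · have h1 : ∑ x ∈ A.erase v, dg H x ≤ ∑ x ∈ A.erase v, (dg H' x + if H.Adj v x then 2 else 0) :=
        Finset.sum_le_sum (fun x hx => hge x (Finset.mem_erase.1 hx).1)
      rw [Finset.sum_add_distrib, Finset.sum_ite] at h1
      simp only [Finset.sum_const, smul_eq_mul, mul_zero, add_zero] at h1
      have h2 : ((A.erase v).filter (fun x => H.Adj v x)).card ≤ dg H v := by
        apply Finset.card_le_card
        intro x; simp
      have h3 : 3 * d * (A.erase v).card + 3 * d ≤ ∑ x ∈ A, dg H x := by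
        rw [← hcard] at hsum
        linarith
      omega
  have := hmin _ (by rw [Finset.mem_filter]; exact ⟨Finset.mem_univ _, hQ'⟩)
  have := Finset.card_erase_add_one hv
  omega

theorem exists_regular (G : SimpleGraph V) [Nonempty V] {n : ℕ} (hn : 1 ≤ n)
    (hG : ∀ v, 3000 * n + 2 ≤ dg G v) (hK : ¬ HasK n G) :
    ∃ H, Imm G H ∧ ∃ A : Finset V, A.Nonempty ∧ (∀ x ∉ A, dg H x = 0) ∧
      ∀ x ∈ A, dg H x = 1000 * n := by
  obtain ⟨H0, hI0, A, hAne, hev0, h00, hd0⟩ := exists_mindeg G (d := 1000 * n) (by omega)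
    (fun v => by have := hG v; omega)
  let Q : SimpleGraph V → Prop := fun H => Imm G H ∧ (∀ x, Even (dg H x)) ∧
    (∀ x ∉ A, dg H x = 0) ∧ ∀ x ∈ A, 1000 * n ≤ dg H x
  obtain ⟨H, hH, hmin⟩ := Finset.exists_min_image (Finset.univ.filter Q)
    (fun H => ∑ x, dg H x) ⟨H0, by rw [Finset.mem_filter]; exact ⟨Finset.mem_univ _, hI0, hev0, h00, hd0⟩⟩
  obtain ⟨hI, hev, h0, hd⟩ := (Finset.mem_filter.1 hH).2
  refine ⟨H, hI, A, hAne, h0, ?_⟩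
  intro v hv
  by_contra hne
  have hge : 1000 * n + 2 ≤ dg H v := by
    have h1 := hd v hv
    obtain ⟨r, hr⟩ := hev v
    omega
  have hncl : ∃ p ∈ nb H v, ∃ q ∈ nb H v, p ≠ q ∧ ¬ H.Adj p q := by
    by_contra hcon
    push Not at hcon
    refine hK (HasK.of_imm hI (hasK_of_clique (nb H v) ?_ hcon))
    unfold dg at hge; omega
  obtain ⟨p, hp, q, hq, hpq, hnadj⟩ := hncl
  have hss : SSD H v {p} (fun _ => q) := by
    refine ⟨by simp, ?_, ?_, ?_, ?_⟩
    · intro x _; simpa using hpq.symm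
    · intro x hx; rw [Finset.mem_singleton] at hx; subst hx; simpa using hp
    · intro x hx; simpa using hq
    · intro x hx; rw [Finset.mem_singleton] at hx; subst hx; exact hnadj
  have hdv := ss_dg_a hss
  rw [Finset.card_singleton] at hdv
  have hQ' : Q (SS H v {p} (fun _ => q)) := by
    refine ⟨hI.trans (ss_imm hss), ?_, ?_, ?_⟩
    · intro x
      by_cases hx : x = v
      · subst hx
        obtain ⟨r, hr⟩ := hev x
        exact ⟨r - 1, by omega⟩
      · rw [ss_dg hss hx]; exact hev x
    · intro x hx
      have : x ≠ v := fun h => hx (h ▸ hv)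
      rw [ss_dg hss this]; exact h0 x hx
    · intro x hx
      by_cases hxv : x = v
      · subst hxv; omega
      · rw [ss_dg hss hxv]; exact hd x hx
  have h1 := hmin _ (by rw [Finset.mem_filter]; exact ⟨Finset.mem_univ _, hQ'⟩)
  have h2 : ∑ x, dg (SS H v {p} (fun _ => q)) x < ∑ x, dg H x := by
    apply Finset.sum_lt_sum
    · intro x _
      by_cases hxv : x = v
      · subst hxv; omega
      · rw [ss_dg hss hxv]
    · exact ⟨v, Finset.mem_univ _, by omega⟩
  omega

end TOI

end

section

namespace TOI
open SimpleGraph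
open scoped Classical
set_option linter.unusedSectionVars false
set_option linter.unusedVariables false
variable {V : Type*} [Fintype V]

/-- state of phase one -/
structure St1 (n : ℕ) (H0 : SimpleGraph V) (v : V) (W0 : Finset V)
    (H : SimpleGraph V) (M Pr W : Finset V) : Prop where
  imm : Imm H0 H
  same : ∀ x ∉ M, dg H x = dg H0 x
  ev : ∀ x, Even (dg H x)
  le : ∀ x, dg H x ≤ 1000 * n
  vM : v ∈ M
  dis : ∀ x ∈ M, x ∉ W0
  adj : ∀ x ∈ W0, ∀ y ∈ W0, (H.Adj x y ↔ H0.Adj x y)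
  prM : Pr ⊆ M
  nbPr : ∀ b ∈ Pr, nb H b ⊆ M ∪ W0
  WW : W ⊆ W0
  Wc : W0.card ≤ W.card + M.card
  full : ∀ b ∈ M, b ∉ Pr → ∀ w ∈ W, H.Adj b w
  big : ∀ b ∈ M, 1000 * n ≤ (nb H b ∩ W0).card + 18 * n
  Mc : M.card < n

theorem many_common {n : ℕ} (hn : 1 ≤ n) {H : SimpleGraph V} {M W0 : Finset V} (hMc : n ≤ M.card)
    (hdis : ∀ x ∈ M, x ∉ W0) (hW0 : W0.card ≤ 1000 * n)
    (hbig : ∀ b ∈ M, 1000 * n ≤ (nb H b ∩ W0).card + 18 * n) : HasK n H := by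
  obtain ⟨φ, hφ, hφM⟩ := exists_fin_of_card hMc
  refine L2 φ hφ W0 (fun i => hdis _ (hφM i)) ?_
  intro i j hij
  have h1 := card_union_inter (nb H (φ i) ∩ W0) (nb H (φ j) ∩ W0)
  have h2 : (nb H (φ i) ∩ W0) ∩ (nb H (φ j) ∩ W0) = nb H (φ i) ∩ nb H (φ j) ∩ W0 := by
    ext; simp only [Finset.mem_inter]; tauto
  have h3 : ((nb H (φ i) ∩ W0) ∪ (nb H (φ j) ∩ W0)).card ≤ W0.card := by
    apply Finset.card_le_card; intro x; simp only [Finset.mem_union, Finset.mem_inter]; tauto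
  rw [h2] at h1
  have := hbig _ (hφM i)
  have := hbig _ (hφM j)
  omega

theorem st1_step {n : ℕ} (hn : 1 ≤ n) {H0 : SimpleGraph V} (hK : ¬ HasK n H0) {v : V}
    {W0 : Finset V} (hW0 : W0.card ≤ 1000 * n) (hW0' : 1000 * n ≤ W0.card + 8 * n)
    {H : SimpleGraph V} {M Pr W : Finset V} (st : St1 n H0 v W0 H M Pr W)
    {a : V} (haM : a ∈ M) (haPr : a ∉ Pr) :
    ∃ H' M' W', St1 n H0 v W0 H' M' (insert a Pr) W' := by
  set O := nb H a \ (W0 ∪ M) with hO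
  have hWc : 1000 * n ≤ W.card + 9 * n := by
    have := st.Wc; have := st.Mc; omega
  have hOc : O.card + W.card ≤ 1000 * n := by
    have hs : O ∪ W ⊆ nb H a := by
      intro x hx
      rcases Finset.mem_union.1 hx with h | h
      · exact (Finset.mem_sdiff.1 h).1
      · simpa using st.full a haM haPr x h
    have hd : Disjoint O W := by
      rw [Finset.disjoint_left]
      intro x hx hx'
      exact (Finset.mem_sdiff.1 hx).2 (Finset.mem_union_left _ (st.WW hx'))
    have h1 := Finset.card_le_card hs
    rw [Finset.card_union_of_disjoint hd] at h1
    exact h1.trans (st.le a)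
  have hOm : ∀ x ∈ O, H.Adj a x ∧ x ∉ W0 ∧ x ∉ M := by
    intro x hx; simp only [hO, Finset.mem_sdiff, mem_nb, Finset.mem_union, not_or] at hx; tauto
  let C : Finset V → Finset V := fun T => W.filter (fun w => ∃ p ∈ T, ¬ H.Adj p w)
  obtain ⟨T, hT, hTmax⟩ := Finset.exists_max_image
    (O.powerset.filter (fun T => (C T).card ≤ T.card)) Finset.card ⟨∅, by simp [C]⟩
  rw [Finset.mem_filter, Finset.mem_powerset] at hT
  obtain ⟨hTO, hCT⟩ := hT
  set W' := W \ C T with hW'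
  set O' := O \ T with hO'
  have hCsub : C T ⊆ W := Finset.filter_subset _ _
  have hW'c : W'.card + (C T).card = W.card := Finset.card_sdiff_add_card_eq_card hCsub
  have hO'c : O'.card + T.card = O.card := Finset.card_sdiff_add_card_eq_card hTO
  have hTM : Disjoint M T := by
    rw [Finset.disjoint_left]; intro x hx hx'; exact (hOm x (hTO hx')).2.2 hx
  have hTadj : ∀ p ∈ T, ∀ w ∈ W', H.Adj p w := by
    intro p hp w hw
    by_contra hcon
    rw [hW', Finset.mem_sdiff] at hw
    exact hw.2 (Finset.mem_filter.2 ⟨hw.1, p, hp, hcon⟩)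
  have hTbig : ∀ p ∈ T, 1000 * n ≤ (nb H p ∩ W0).card + 18 * n := by
    intro p hp
    have hs : W' ⊆ nb H p ∩ W0 := by
      intro w hw
      rw [Finset.mem_inter, mem_nb]
      exact ⟨hTadj p hp w hw, st.WW (Finset.mem_sdiff.1 hw).1⟩
    have := Finset.card_le_card hs
    omega
  have hM'dis : ∀ x ∈ M ∪ T, x ∉ W0 := by
    intro x hx
    rcases Finset.mem_union.1 hx with h | h
    · exact st.dis x h
    · exact (hOm x (hTO h)).2.1
  have hM'c : (M ∪ T).card < n := by
    by_contra hcon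
    push Not at hcon
    refine hK (HasK.of_imm st.imm (many_common hn hcon hM'dis hW0 ?_))
    intro b hb
    rcases Finset.mem_union.1 hb with h | h
    · exact st.big b h
    · exact hTbig b h
  -- Hall
  have hhall : ∃ f : {p // p ∈ O'} → V, Function.Injective f ∧
      ∀ p, f p ∈ W'.filter (fun w => ¬ H.Adj p.1 w) := by
    rw [← Finset.all_card_le_biUnion_card_iff_exists_injective]
    intro s
    by_contra hcon
    push Not at hcon
    set S := s.image (fun p => p.1) with hS
    have hSc : S.card = s.card := Finset.card_image_of_injective _ Subtype.val_injective
    have hSO : S ⊆ O' := by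
      intro x hx
      obtain ⟨p, _, rfl⟩ := Finset.mem_image.1 hx
      exact p.2
    have hdisj : Disjoint T S := by
      rw [Finset.disjoint_left]; intro x hx hx'
      exact (Finset.mem_sdiff.1 (hSO hx')).2 hx
    have hcov : C (T ∪ S) ⊆ C T ∪ s.biUnion (fun p => W'.filter (fun w => ¬ H.Adj p.1 w)) := by
      intro w hw
      obtain ⟨hwW, p, hp, hpw⟩ := Finset.mem_filter.1 hw
      by_cases hwC : w ∈ C T
      · exact Finset.mem_union_left _ hwC
      · refine Finset.mem_union_right _ ?_
        rcases Finset.mem_union.1 hp with h | h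
        · exact absurd (Finset.mem_filter.2 ⟨hwW, p, h, hpw⟩) hwC
        · obtain ⟨q, hq, rfl⟩ := Finset.mem_image.1 h
          rw [Finset.mem_biUnion]
          exact ⟨q, hq, Finset.mem_filter.2 ⟨Finset.mem_sdiff.2 ⟨hwW, hwC⟩, hpw⟩⟩
    have h1 := (Finset.card_le_card hcov).trans (Finset.card_union_le _ _)
    have h2 := Finset.card_union_of_disjoint hdisj
    have h3 := hTmax (T ∪ S) (by
      rw [Finset.mem_filter, Finset.mem_powerset]
      refine ⟨Finset.union_subset hTO (hSO.trans Finset.sdiff_subset), ?_⟩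
      omega)
    omega
  obtain ⟨f, hf, hfm⟩ := hhall
  let g : V → V := fun p => if h : p ∈ O' then f ⟨p, h⟩ else p
  have hgv : ∀ p (hp : p ∈ O'), g p = f ⟨p, hp⟩ := fun p hp => by simp [g, hp]
  have hgm : ∀ p ∈ O', g p ∈ W' ∧ ¬ H.Adj p (g p) := by
    intro p hp
    rw [hgv p hp]
    exact Finset.mem_filter.1 (hfm ⟨p, hp⟩)
  have hW'W : ∀ w ∈ W', w ∈ W := fun w hw => (Finset.mem_sdiff.1 hw).1
  have hW'W0 : ∀ w ∈ W', w ∈ W0 := fun w hw => st.WW (hW'W w hw)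
  have hO'O : ∀ p ∈ O', p ∈ O := fun p hp => (Finset.mem_sdiff.1 hp).1
  have hss : SSD H a O' g := by
    refine ⟨?_, ?_, ?_, ?_, ?_⟩
    · intro p hp q hq hpq
      rw [hgv p hp, hgv q hq] at hpq
      exact Subtype.ext_iff.1 (hf hpq)
    · intro p hp hgp
      exact (hOm _ (hO'O _ hgp)).2.1 (hW'W0 _ (hgm p hp).1)
    · intro p hp; exact (hOm p (hO'O p hp)).1
    · intro p hp; exact st.full a haM haPr _ (hW'W _ (hgm p hp).1)
    · intro p hp; exact (hgm p hp).2
  have himg : ∀ x ∈ O'.image g, x ∈ W' := by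
    intro x hx
    obtain ⟨p, hp, rfl⟩ := Finset.mem_image.1 hx
    exact (hgm p hp).1
  have hnbM : ∀ b ∈ M ∪ T, b ≠ a → nb (SS H a O' g) b = nb H b := by
    intro b hb hba
    refine ss_nb_other hss hba ?_ ?_
    · intro hbO
      rcases Finset.mem_union.1 hb with h | h
      · exact (hOm b (hO'O b hbO)).2.2 h
      · exact (Finset.mem_sdiff.1 hbO).2 h
    · intro h
      exact hM'dis b hb (hW'W0 b (himg b h))
  have hdga := ss_dg_a hss
  refine ⟨SS H a O' g, M ∪ T, W', ?_⟩
  constructor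
  · exact st.imm.trans (ss_imm hss)
  · intro x hx
    rw [Finset.mem_union, not_or] at hx
    have hxa : x ≠ a := fun h => hx.1 (h ▸ haM)
    rw [ss_dg hss hxa]
    exact st.same x hx.1
  · intro x
    by_cases hx : x = a
    · subst hx
      obtain ⟨r, hr⟩ := st.ev x
      exact ⟨r - O'.card, by omega⟩
    · rw [ss_dg hss hx]; exact st.ev x
  · intro x
    by_cases hx : x = a
    · subst hx; have := st.le x; omega
    · rw [ss_dg hss hx]; exact st.le x
  · exact Finset.mem_union_left _ st.vM
  · exact hM'dis
  · intro x hx y hy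
    have hxa : x ≠ a := fun h => st.dis a haM (h ▸ hx)
    have hya : y ≠ a := fun h => st.dis a haM (h ▸ hy)
    rw [ss_adj hss hxa hya, ← st.adj x hx y hy]
    constructor
    · rintro (h | h | h)
      · exact h
      · exact absurd hx (hOm x (hO'O x h.1)).2.1
      · exact absurd hy (hOm y (hO'O y h.1)).2.1
    · exact Or.inl
  · intro x hx
    rcases Finset.mem_insert.1 hx with rfl | hx
    · exact Finset.mem_union_left _ haM
    · exact Finset.mem_union_left _ (st.prM hx)
  · intro b hb
    rcases Finset.mem_insert.1 hb with rfl | hb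
    · rw [ss_nb_a hss]
      intro x hx
      rw [Finset.mem_sdiff, Finset.mem_union, not_or] at hx
      by_cases hxO : x ∈ O
      · have : x ∈ T := by
          by_contra hxT
          exact hx.2.1 (Finset.mem_sdiff.2 ⟨hxO, hxT⟩)
        simp [this]
      · have : x ∈ W0 ∪ M := by
          by_contra h
          exact hxO (Finset.mem_sdiff.2 ⟨hx.1, h⟩)
        simp only [Finset.mem_union] at this ⊢
        tauto
    · rw [hnbM b (Finset.mem_union_left _ (st.prM hb)) (fun h => haPr (h ▸ hb))]
      intro x hx
      have := st.nbPr b hb hx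
      simp only [Finset.mem_union] at this ⊢
      tauto
  · exact fun w hw => hW'W0 w hw
  · rw [Finset.card_union_of_disjoint hTM]
    have := st.Wc
    omega
  · intro b hb hbP w hw
    rw [Finset.mem_insert, not_or] at hbP
    have : w ∈ nb (SS H a O' g) b := by
      rw [hnbM b hb hbP.1, mem_nb]
      rcases Finset.mem_union.1 hb with h | h
      · exact st.full b h hbP.2 w (hW'W w hw)
      · exact hTadj b h w hw
    simpa using this
  · intro b hb
    by_cases hba : b = a
    · subst hba
      rw [ss_nb_a hss]
      have hs : W \ O'.image g ⊆ (nb H b \ (O' ∪ O'.image g)) ∩ W0 := by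
        intro w hw
        rw [Finset.mem_sdiff] at hw
        rw [Finset.mem_inter, Finset.mem_sdiff, Finset.mem_union, not_or, mem_nb]
        exact ⟨⟨st.full b haM haPr w hw.1, fun h => (hOm w (hO'O w h)).2.1 (st.WW hw.1), hw.2⟩,
          st.WW hw.1⟩
      have h1 := Finset.card_le_card hs
      have h2 := Finset.le_card_sdiff (O'.image g) W
      have h3 := Finset.card_image_le (s := O') (f := g)
      omega
    · rw [hnbM b hb hba]
      rcases Finset.mem_union.1 hb with h | h
      · exact st.big b h
      · exact hTbig b h
  · exact hM'c

theorem phase1 {n : ℕ} (hn : 2 ≤ n) {H0 : SimpleGraph V} (hK : ¬ HasK n H0) {v : V}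
    {W0 : Finset V} (hW0 : W0 ⊆ nb H0 v) (hW0' : 1000 * n ≤ W0.card + 8 * n)
    (hev : ∀ x, Even (dg H0 x)) (hle : ∀ x, dg H0 x ≤ 1000 * n) :
    ∃ H M W, St1 n H0 v W0 H M M W := by
  have hW0c : W0.card ≤ 1000 * n := (Finset.card_le_card hW0).trans (hle v)
  let Q : Finset V → Prop := fun Pr => ∃ H M W, St1 n H0 v W0 H M Pr W
  have hQ : Q ∅ := by
    refine ⟨H0, {v}, W0, ?_⟩
    constructor
    · exact Imm.refl _
    · intro x _; rfl
    · exact hev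
    · exact hle
    · simp
    · intro x hx hx'
      rw [Finset.mem_singleton] at hx
      subst hx
      have := hW0 hx'
      simp at this
    · intro x _ y _; rfl
    · simp
    · simp
    · exact le_rfl
    · simp
    · intro b hb _ w hw
      rw [Finset.mem_singleton] at hb
      subst hb
      simpa using hW0 hw
    · intro b hb
      rw [Finset.mem_singleton] at hb
      subst hb
      rw [Finset.inter_eq_right.2 hW0]
      omega
    · simp; omega
  obtain ⟨Pr, hPr, hmax⟩ := Finset.exists_max_image (Finset.univ.filter Q) Finset.card
    ⟨∅, by rw [Finset.mem_filter]; exact ⟨Finset.mem_univ _, hQ⟩⟩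
  obtain ⟨H, M, W, st⟩ := (Finset.mem_filter.1 hPr).2
  have : Pr = M := by
    refine Finset.Subset.antisymm st.prM ?_
    intro a ha
    by_contra haP
    obtain ⟨H', M', W', st'⟩ := st1_step (by omega) hK hW0c hW0' st ha haP
    have h1 := hmax (insert a Pr) (by
      rw [Finset.mem_filter]; exact ⟨Finset.mem_univ _, H', M', W', st'⟩)
    rw [Finset.card_insert_of_notMem haP] at h1
    omega
  subst this
  exact ⟨H, Pr, W, st⟩

end TOI

end

section

namespace TOI
open SimpleGraph
open scoped Classical
set_option linter.unusedSectionVars false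
set_option linter.unusedVariables false
variable {V : Type*} [Fintype V]

theorem s2_nb_x {H : SimpleGraph V} {x a c y : V} (h : S2D H x a c y) :
    nb (S2 H x a c y) x = insert y ((nb H x).erase a) := by
  have n1 := h.xa.ne
  have n2 := h.ac.ne
  have n3 := h.cy.ne
  have n4 := h.nxy
  have n5 := h.nxc
  have n6 := h.nya
  ext w
  simp only [mem_nb, Finset.mem_insert, Finset.mem_erase, s2_adj h, Sym2.eq_iff]
  grind

theorem s2_nb_y {H : SimpleGraph V} {x a c y : V} (h : S2D H x a c y) :
    nb (S2 H x a c y) y = insert x ((nb H y).erase c) := by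
  have n1 := h.xa.ne
  have n2 := h.ac.ne
  have n3 := h.cy.ne
  have n4 := h.nxy
  have n5 := h.nxc
  have n6 := h.nya
  ext w
  simp only [mem_nb, Finset.mem_insert, Finset.mem_erase, s2_adj h, Sym2.eq_iff]
  grind

theorem s2_nb_other {H : SimpleGraph V} {x a c y : V} (h : S2D H x a c y) {z : V}
    (h1 : z ≠ x) (h2 : z ≠ a) (h3 : z ≠ c) (h4 : z ≠ y) :
    nb (S2 H x a c y) z = nb H z := by
  ext w
  simp only [mem_nb, s2_adj h, Sym2.eq_iff]
  grind

theorem card_swap_inter {N S : Finset V} {a b : V} (ha : a ∈ N) (haS : a ∈ S) :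
    (insert b (N.erase a) ∩ S).card ≤ (N ∩ S).card := by
  have h1 : insert b (N.erase a) ∩ S ⊆ insert b ((N ∩ S).erase a) := by
    intro x; simp only [Finset.mem_inter, Finset.mem_insert, Finset.mem_erase]; tauto
  have h2 := Finset.card_le_card h1
  have h3 := Finset.card_insert_le b ((N ∩ S).erase a)
  have h4 := Finset.card_erase_add_one (Finset.mem_inter.2 ⟨ha, haS⟩)
  omega

theorem ss_nb_form {H : SimpleGraph V} {a : V} {P : Finset V} {g : V → V} (h : SSD H a P g)
    {x : V} (hx : x ≠ a) : nb (SS H a P g) x = nb H x ∨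
      ∃ q, H.Adj x a ∧ nb (SS H a P g) x ⊆ insert q ((nb H x).erase a) := by
  by_cases hxP : x ∈ P
  · right
    refine ⟨g x, (h.adj1 x hxP).symm, ?_⟩
    intro y
    simp only [mem_nb, Finset.mem_insert, Finset.mem_erase]
    by_cases hy : y = a
    · subst hy
      rw [SimpleGraph.adj_comm, ss_adj_a h]
      tauto
    · rw [ss_adj h hx hy]
      rintro (h' | h' | h')
      · exact Or.inr ⟨hy, h'⟩
      · exact Or.inl h'.2
      · exact absurd (h'.2 ▸ hxP) (h.dis y h'.1)
  by_cases hxg : x ∈ P.image g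
  · obtain ⟨p, hp, rfl⟩ := Finset.mem_image.1 hxg
    right
    refine ⟨p, (h.adj2 p hp).symm, ?_⟩
    intro y
    simp only [mem_nb, Finset.mem_insert, Finset.mem_erase]
    by_cases hy : y = a
    · subst hy
      rw [SimpleGraph.adj_comm, ss_adj_a h]
      tauto
    · rw [ss_adj h hx hy]
      rintro (h' | h' | h')
      · exact Or.inr ⟨hy, h'⟩
      · exact absurd h'.1 hxP
      · exact Or.inl (h.inj h'.1 hp h'.2.symm)
  · exact Or.inl (ss_nb_other h hx hxP hxg)

/-- state of phase two (first half) -/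
structure St2 (n : ℕ) (H0 : SimpleGraph V) (W0 M : Finset V) (H : SimpleGraph V) : Prop where
  imm : Imm H0 H
  same : ∀ x ∉ M, dg H x = dg H0 x
  ev : ∀ x, Even (dg H x)
  sub : ∀ b ∈ M, nb H b ⊆ M ∪ W0
  big : ∀ b ∈ M, (nb H b ∩ M).card + 1000 * n ≤ (nb H b ∩ W0).card + 19 * n
  sm : ∀ w ∈ W0, (nb H w ∩ (W0 ∪ M)).card < 401 * n

theorem phase2a {n : ℕ} (hn : 2 ≤ n) {H0 : SimpleGraph V} {W0 M : Finset V}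
    (hdis : ∀ x ∈ M, x ∉ W0) {H1 : SimpleGraph V} (st1 : St2 n H0 W0 M H1) :
    ∃ H, St2 n H0 W0 M H ∧ ∀ a ∈ M, ∀ c ∈ M, ¬ H.Adj a c := by
  obtain ⟨H, hH, hmin⟩ := Finset.exists_min_image (Finset.univ.filter (St2 n H0 W0 M))
    (fun H => ∑ x, dg H x) ⟨H1, by rw [Finset.mem_filter]; exact ⟨Finset.mem_univ _, st1⟩⟩
  have st := (Finset.mem_filter.1 hH).2
  refine ⟨H, st, ?_⟩
  intro a ha c hc hac
  have hx : (nb H a ∩ W0).Nonempty := by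
    rw [← Finset.card_pos]; have := st.big a ha; omega
  obtain ⟨x, hx⟩ := hx
  rw [Finset.mem_inter, mem_nb] at hx
  have hy : (((nb H c ∩ W0) \ (nb H x ∩ (W0 ∪ M))).erase x).Nonempty := by
    rw [← Finset.card_pos]
    have h1 := st.big c hc
    have h2 := st.sm x hx.2
    have h3 := Finset.le_card_sdiff (nb H x ∩ (W0 ∪ M)) (nb H c ∩ W0)
    have h4 := Finset.pred_card_le_card_erase
      (s := (nb H c ∩ W0) \ (nb H x ∩ (W0 ∪ M))) (a := x)
    omega
  obtain ⟨y, hy⟩ := hy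
  simp only [Finset.mem_erase, Finset.mem_sdiff, Finset.mem_inter, mem_nb, Finset.mem_union] at hy
  have hd : S2D H x a c y := by
    refine ⟨hx.1.symm, hac, hy.2.1.1, ?_, hy.1.symm, ?_, ?_⟩
    · intro h; exact hy.2.2 ⟨h, Or.inl hy.2.1.2⟩
    · intro h; exact hdis c hc (h ▸ hx.2)
    · intro h; exact hdis a ha (h ▸ hy.2.1.2)
  have hxW := hx.2
  have hyW := hy.2.1.2
  have hcardE : ∀ N : Finset V, ∀ p ∈ N, ∀ q ∈ N, p ≠ q →
      ((N.erase p).erase q).card + 2 = N.card := by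
    intro N p hp q hq hpq
    have h1 := Finset.card_erase_add_one hp
    have h2 := Finset.card_erase_add_one (s := N.erase p) (Finset.mem_erase.2 ⟨hpq.symm, hq⟩)
    omega
  have hdga : dg (S2 H x a c y) a + 2 = dg H a := by
    unfold dg; rw [s2_nb_a hd]
    exact hcardE _ x (by simpa using hx.1) c (by simpa using hac) hd.nxc
  have hdgc : dg (S2 H x a c y) c + 2 = dg H c := by
    unfold dg; rw [s2_nb_c hd]
    exact hcardE _ y (by simpa using hd.cy) a (by simpa using hac.symm) hd.nya
  have hbig : ∀ N : Finset V, ∀ p ∈ N, ∀ q ∈ N, p ∈ W0 → q ∈ M →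
      (N ∩ M).card + 1000 * n ≤ (N ∩ W0).card + 19 * n →
      (((N.erase p).erase q) ∩ M).card + 1000 * n ≤ (((N.erase p).erase q) ∩ W0).card + 19 * n := by
    intro N p hp q hq hpW hqM h
    have e1 : ((N.erase p).erase q) ∩ M ⊆ (N ∩ M).erase q := by
      intro z; simp only [Finset.mem_inter, Finset.mem_erase]; tauto
    have e2 : (N ∩ W0).erase p ⊆ ((N.erase p).erase q) ∩ W0 := by
      intro z
      have : z ∈ W0 → z ≠ q := fun hz h => hdis q hqM (h ▸ hz)
      simp only [Finset.mem_inter, Finset.mem_erase]; tauto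
    have h1 := Finset.card_le_card e1
    have h2 := Finset.card_le_card e2
    have h3 := Finset.card_erase_add_one (Finset.mem_inter.2 ⟨hq, hqM⟩)
    have h4 := Finset.card_erase_add_one (Finset.mem_inter.2 ⟨hp, hpW⟩)
    omega
  have hMother : ∀ b ∈ M, b ≠ a → b ≠ c → nb (S2 H x a c y) b = nb H b := by
    intro b hb h1 h2
    exact s2_nb_other hd (fun h => hdis b hb (h ▸ hxW)) h1 h2 (fun h => hdis b hb (h ▸ hyW))
  have st' : St2 n H0 W0 M (S2 H x a c y) := by
    constructor
    · exact st.imm.trans (s2_imm hd)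
    · intro z hz
      have hza : z ≠ a := fun h => hz (h ▸ ha)
      have hzc : z ≠ c := fun h => hz (h ▸ hc)
      rw [s2_dg_other hd hza hzc]
      exact st.same z hz
    · intro z
      by_cases hza : z = a
      · subst hza
        obtain ⟨r, hr⟩ := st.ev z
        exact ⟨r - 1, by omega⟩
      by_cases hzc : z = c
      · subst hzc
        obtain ⟨r, hr⟩ := st.ev z
        exact ⟨r - 1, by omega⟩
      rw [s2_dg_other hd hza hzc]; exact st.ev z
    · intro b hb
      by_cases hba : b = a
      · subst hba; rw [s2_nb_a hd]
        exact ((Finset.erase_subset _ _).trans (Finset.erase_subset _ _)).trans (st.sub _ hb)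
      by_cases hbc : b = c
      · subst hbc; rw [s2_nb_c hd]
        exact ((Finset.erase_subset _ _).trans (Finset.erase_subset _ _)).trans (st.sub _ hb)
      rw [hMother b hb hba hbc]; exact st.sub b hb
    · intro b hb
      by_cases hba : b = a
      · subst hba; rw [s2_nb_a hd]
        exact hbig _ x (by simpa using hx.1) c (by simpa using hac) hxW hc (st.big _ hb)
      by_cases hbc : b = c
      · subst hbc; rw [s2_nb_c hd]
        exact hbig _ y (by simpa using hd.cy) a (by simpa using hac.symm) hyW ha (st.big _ hb)
      rw [hMother b hb hba hbc]; exact st.big b hb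
    · intro w hw
      by_cases hwx : w = x
      · subst hwx; rw [s2_nb_x hd]
        exact (card_swap_inter (by simpa using hd.xa) (Finset.mem_union_right _ ha)).trans_lt
          (st.sm w hw)
      by_cases hwy : w = y
      · subst hwy; rw [s2_nb_y hd]
        exact (card_swap_inter (by simpa using hd.cy.symm) (Finset.mem_union_right _ hc)).trans_lt
          (st.sm w hw)
      rw [s2_nb_other hd hwx (fun h => hdis a ha (h ▸ hw)) (fun h => hdis c hc (h ▸ hw)) hwy]
      exact st.sm w hw
  have h1 := hmin _ (by rw [Finset.mem_filter]; exact ⟨Finset.mem_univ _, st'⟩)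
  have h2 : ∑ z, dg (S2 H x a c y) z < ∑ z, dg H z := by
    apply Finset.sum_lt_sum
    · intro z _
      by_cases hza : z = a
      · subst hza; omega
      by_cases hzc : z = c
      · subst hzc; omega
      rw [s2_dg_other hd hza hzc]
    · exact ⟨a, Finset.mem_univ _, by omega⟩
  omega

/-- state of phase two (second half) -/
structure St3 (n : ℕ) (H0 : SimpleGraph V) (W0 M Z : Finset V) (H : SimpleGraph V) : Prop where
  imm : Imm H0 H
  same : ∀ x ∉ M, dg H x = dg H0 x
  ev : ∀ x, Even (dg H x)
  sub : ∀ b ∈ M, nb H b ⊆ W0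
  zero : ∀ b ∈ Z, dg H b = 0
  big : ∀ b ∈ M, b ∉ Z → 1000 * n ≤ dg H b + 19 * n
  sm : ∀ w ∈ W0, (nb H w ∩ (W0 ∪ M)).card < 401 * n

theorem phase2b {n : ℕ} (hn : 2 ≤ n) {H0 : SimpleGraph V} {W0 M : Finset V}
    (hdis : ∀ x ∈ M, x ∉ W0) {H1 : SimpleGraph V} (st1 : St3 n H0 W0 M ∅ H1) :
    ∃ H Z, St3 n H0 W0 M Z H ∧ M ⊆ Z := by
  let Q : Finset V → Prop := fun Z => ∃ H, St3 n H0 W0 M Z H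
  obtain ⟨Z, hZ, hmax⟩ := Finset.exists_max_image (Finset.univ.filter Q)
    Finset.card ⟨∅, by rw [Finset.mem_filter]; exact ⟨Finset.mem_univ _, H1, st1⟩⟩
  obtain ⟨H, st⟩ := (Finset.mem_filter.1 hZ).2
  refine ⟨H, Z, st, ?_⟩
  intro b hb
  by_contra hbZ
  have hbig := st.big b hb hbZ
  have hsub := st.sub b hb
  obtain ⟨P, hP, g, hg, him, hna⟩ := perfect_pairing H (nb H b) (st.ev b) (by
    intro x hx
    have h1 := st.sm x (hsub hx)
    have h2 : (nb H x ∩ nb H b).card ≤ (nb H x ∩ (W0 ∪ M)).card := by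
      apply Finset.card_le_card
      intro z; simp only [Finset.mem_inter, Finset.mem_union]
      intro hz; exact ⟨hz.1, Or.inl (hsub hz.2)⟩
    unfold dg at hbig
    omega)
  have hgm : ∀ p ∈ P, g p ∈ nb H b ∧ g p ∉ P := by
    intro p hp
    have : g p ∈ nb H b \ P := him ▸ Finset.mem_image_of_mem g hp
    simpa using this
  have hss : SSD H b P g := by
    refine ⟨hg, fun p hp => (hgm p hp).2, fun p hp => by simpa using hP hp,
      fun p hp => by simpa using (hgm p hp).1, hna⟩
  have hnbb : nb (SS H b P g) b = ∅ := by
    rw [ss_nb_a hss, him]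
    ext z; simp
    tauto
  have hMother : ∀ c ∈ M, c ≠ b → nb (SS H b P g) c = nb H c := by
    intro c hc hcb
    refine ss_nb_other hss hcb ?_ ?_
    · intro h; exact hdis c hc (hsub (hP h))
    · intro h
      rw [him] at h
      exact hdis c hc (hsub (Finset.mem_sdiff.1 h).1)
  have st' : St3 n H0 W0 M (insert b Z) (SS H b P g) := by
    constructor
    · exact st.imm.trans (ss_imm hss)
    · intro x hx
      have hxb : x ≠ b := fun h => hx (h ▸ hb)
      rw [ss_dg hss hxb]; exact st.same x hx
    · intro x
      by_cases hxb : x = b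
      · subst hxb; unfold dg; rw [hnbb]; simp
      · rw [ss_dg hss hxb]; exact st.ev x
    · intro c hc
      by_cases hcb : c = b
      · subst hcb; rw [hnbb]; simp
      · rw [hMother c hc hcb]; exact st.sub c hc
    · intro c hc
      by_cases hcb : c = b
      · subst hcb; unfold dg; rw [hnbb]; simp
      · rw [ss_dg hss hcb]; exact st.zero c (by simpa [hcb] using hc)
    · intro c hc hcZ
      rw [Finset.mem_insert, not_or] at hcZ
      rw [ss_dg hss hcZ.1]; exact st.big c hc hcZ.2
    · intro w hw
      have hwb : w ≠ b := fun h => hdis b hb (h ▸ hw)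
      rcases ss_nb_form hss hwb with h | ⟨q, hq1, hq2⟩
      · rw [h]; exact st.sm w hw
      · refine lt_of_le_of_lt ?_ (st.sm w hw)
        refine (Finset.card_le_card (Finset.inter_subset_inter_right hq2)).trans ?_
        exact card_swap_inter (by simpa using hq1) (Finset.mem_union_right _ hb)
  have h1 := hmax _ (by rw [Finset.mem_filter]; exact ⟨Finset.mem_univ _, _, st'⟩)
  rw [Finset.card_insert_of_notMem hbZ] at h1
  omega

theorem main2 {n : ℕ} (hn : 2 ≤ n) {H0 : SimpleGraph V} (hK : ¬ HasK n H0) {A : Finset V}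
    (hA : A.Nonempty) (h0 : ∀ x ∉ A, dg H0 x = 0) (hd : ∀ x ∈ A, dg H0 x = 1000 * n) :
    ∃ H, Imm H0 H ∧ ∃ A' : Finset V, A'.Nonempty ∧ A'.card < A.card ∧ (∀ x ∉ A', dg H x = 0) ∧
      ∀ x ∈ A', dg H x = 1000 * n := by
  obtain ⟨v, hv⟩ := hA
  have hev : ∀ x, Even (dg H0 x) := by
    intro x
    by_cases hx : x ∈ A
    · rw [hd x hx]; exact ⟨500 * n, by ring⟩
    · rw [h0 x hx]; simp
  have hle : ∀ x, dg H0 x ≤ 1000 * n := by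
    intro x
    by_cases hx : x ∈ A
    · rw [hd x hx]
    · rw [h0 x hx]; simp
  set fat := (nb H0 v).filter (fun x => 400 * n ≤ (nb H0 x ∩ nb H0 v).card) with hfat
  have hfatc : fat.card < 8 * n := by
    by_contra hcon
    push Not at hcon
    exact hK (lemmaA (by omega) fat (nb H0 v) hcon (hle v)
      (fun x hx => (Finset.mem_filter.1 hx).2))
  set W0 := nb H0 v \ fat with hW0
  have hW0s : W0 ⊆ nb H0 v := Finset.sdiff_subset
  have hW0c : 1000 * n ≤ W0.card + 8 * n := by
    have h1 : W0.card + fat.card = (nb H0 v).card :=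
      Finset.card_sdiff_add_card_eq_card (Finset.filter_subset _ _)
    have h2 := hd v hv
    unfold dg at h2
    omega
  have hW0sm : ∀ w ∈ W0, (nb H0 w ∩ W0).card < 400 * n := by
    intro w hw
    have hw' := hw
    rw [hW0, Finset.mem_sdiff, hfat, Finset.mem_filter, not_and, not_le] at hw'
    refine lt_of_le_of_lt ?_ (hw'.2 hw'.1)
    exact Finset.card_le_card (Finset.inter_subset_inter_left hW0s)
  have hW0A : ∀ w ∈ W0, w ∈ A := by
    intro w hw
    by_contra hwA
    have h1 := h0 w hwA
    rw [dg, Finset.card_eq_zero] at h1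
    have : v ∈ nb H0 w := by simpa using (mem_nb.1 (hW0s hw)).symm
    rw [h1] at this; simp at this
  obtain ⟨H1, M, W, st1⟩ := phase1 hn hK hW0s hW0c hev hle
  have hdis := st1.dis
  have st2 : St2 n H0 W0 M H1 := by
    constructor
    · exact st1.imm
    · exact st1.same
    · exact st1.ev
    · exact st1.nbPr
    · intro b hb
      have h1 := st1.big b hb
      have h2 := st1.Mc
      have h3 := Finset.card_le_card (Finset.inter_subset_right : nb H1 b ∩ M ⊆ M)
      omega
    · intro w hw
      have h1 : nb H1 w ∩ (W0 ∪ M) ⊆ (nb H0 w ∩ W0) ∪ M := by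
        intro z hz
        simp only [Finset.mem_inter, Finset.mem_union, mem_nb] at hz ⊢
        rcases hz.2 with h | h
        · exact Or.inl ⟨(st1.adj w hw z h).1 hz.1, h⟩
        · exact Or.inr h
      have h2 := (Finset.card_le_card h1).trans (Finset.card_union_le _ _)
      have h3 := hW0sm w hw
      have h4 := st1.Mc
      omega
  obtain ⟨H2, st2, hind⟩ := phase2a hn hdis st2
  have hsub2 : ∀ b ∈ M, nb H2 b ⊆ W0 := by
    intro b hb x hx
    rcases Finset.mem_union.1 (st2.sub b hb hx) with h | h
    · exact absurd (mem_nb.1 hx) (hind b hb x h)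
    · exact h
  have st3 : St3 n H0 W0 M ∅ H2 := by
    constructor
    · exact st2.imm
    · exact st2.same
    · exact st2.ev
    · exact hsub2
    · simp
    · intro b hb _
      have h1 := st2.big b hb
      rw [Finset.inter_eq_left.2 (hsub2 b hb)] at h1
      unfold dg
      omega
    · exact st2.sm
  obtain ⟨H, Z, st, hZ⟩ := phase2b hn hdis st3
  refine ⟨H, st.imm, A \ M, ?_, ?_, ?_, ?_⟩
  · have : W0.Nonempty := by rw [← Finset.card_pos]; omega
    obtain ⟨w, hw⟩ := this
    exact ⟨w, Finset.mem_sdiff.2 ⟨hW0A w hw, fun h => hdis w h hw⟩⟩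
  · apply Finset.card_lt_card
    refine ⟨Finset.sdiff_subset, fun h => ?_⟩
    exact (Finset.mem_sdiff.1 (h hv)).2 st1.vM
  · intro x hx
    by_cases hxM : x ∈ M
    · exact st.zero x (hZ hxM)
    · rw [st.same x hxM]
      exact h0 x (fun h => hx (Finset.mem_sdiff.2 ⟨h, hxM⟩))
  · intro x hx
    rw [Finset.mem_sdiff] at hx
    rw [st.same x hx.2]; exact hd x hx.1

theorem no_regular {n : ℕ} (hn : 2 ≤ n) (N : ℕ) : ∀ (H0 : SimpleGraph V) (A : Finset V),
    A.card = N → A.Nonempty → (∀ x ∉ A, dg H0 x = 0) → (∀ x ∈ A, dg H0 x = 1000 * n) →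
    HasK n H0 := by
  induction N using Nat.strong_induction_on with
  | _ N ih =>
    intro H0 A hc hA h0 hd
    by_contra hK
    obtain ⟨H, hI, A', hA', hlt, h0', hd'⟩ := main2 hn hK hA h0 hd
    exact hK (HasK.of_imm hI (ih A'.card (hc ▸ hlt) H A' rfl hA' h0' hd'))

theorem theoremI {n : ℕ} (hn : 2 ≤ n) (G : SimpleGraph V) [Nonempty V]
    (hG : ∀ v, 3000 * n + 2 ≤ dg G v) : HasK n G := by
  by_contra hK
  obtain ⟨H, hI, A, hA, h0, hd⟩ := exists_regular G (by omega) hG hK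
  exact hK (HasK.of_imm hI (no_regular hn A.card H A rfl hA h0 hd))

end TOI

end

section

namespace TOI
open SimpleGraph
open scoped Classical
set_option linter.unusedSectionVars false
set_option linter.unusedVariables false
variable {V : Type*} [Fintype V]

/-- number of edges leaving a set -/
noncomputable def cut (B : SimpleGraph V) (Z : Finset V) : ℕ :=
  ∑ p, ∑ q, if p ∈ Z ∧ q ∉ Z ∧ B.Adj p q then 1 else 0

/-- number of tokens in a set -/
noncomputable def cnt {I : Type} [Fintype I] (y : I → V) (Z : Finset V) : ℕ :=
  ∑ i, if y i ∈ Z then 1 else 0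

theorem cut_submod (B : SimpleGraph V) (Z W : Finset V) :
    cut B (Z ∩ W) + cut B (Z ∪ W) ≤ cut B Z + cut B W := by
  unfold cut
  simp only [← Finset.sum_add_distrib]
  refine Finset.sum_le_sum fun p _ => Finset.sum_le_sum fun q _ => ?_
  simp only [Finset.mem_inter, Finset.mem_union]
  by_cases h1 : p ∈ Z <;> by_cases h2 : p ∈ W <;> by_cases h3 : q ∈ Z <;> by_cases h4 : q ∈ W <;>
    by_cases h5 : B.Adj p q <;> simp [h1, h2, h3, h4, h5]

theorem cnt_mod {I : Type} [Fintype I] (y : I → V) (Z W : Finset V) :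
    cnt y (Z ∩ W) + cnt y (Z ∪ W) = cnt y Z + cnt y W := by
  unfold cnt
  simp only [← Finset.sum_add_distrib]
  refine Finset.sum_congr rfl fun i _ => ?_
  simp only [Finset.mem_inter, Finset.mem_union]
  by_cases h1 : y i ∈ Z <;> by_cases h2 : y i ∈ W <;> simp [h1, h2]

theorem cnt_option {I : Type} [Fintype I] (y : I → V) (b : V) (Z : Finset V) :
    cnt (fun o : Option I => o.elim b y) Z = cnt y Z + if b ∈ Z then 1 else 0 := by
  unfold cnt
  rw [Fintype.sum_option]
  exact add_comm _ _

theorem cut_delete (B : SimpleGraph V) {a b : V} (hab : B.Adj a b) (Z : Finset V) :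
    cut B Z = cut (B.deleteEdges {s(a, b)}) Z + (if a ∈ Z ∧ b ∉ Z then 1 else 0)
      + (if b ∈ Z ∧ a ∉ Z then 1 else 0) := by
  have hne := hab.ne
  have h1 : ∀ c d : V, (if c ∈ Z ∧ d ∉ Z then 1 else 0) = ∑ p, ∑ q,
      if p = c then (if q = d then (if c ∈ Z ∧ d ∉ Z then 1 else 0) else 0) else 0 := by
    intro c d
    simp
  rw [h1 a b, h1 b a]
  unfold cut
  simp only [← Finset.sum_add_distrib]
  refine Finset.sum_congr rfl fun p _ => Finset.sum_congr rfl fun q _ => ?_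
  simp only [deleteEdges_adj, Set.mem_singleton_iff, Sym2.eq_iff]
  by_cases hp : p = a
  · subst hp
    by_cases hq : q = b
    · subst hq
      simp [hab, hne]
    · simp [hq, hne]
  · by_cases hp' : p = b
    · subst hp'
      by_cases hq : q = a
      · subst hq
        simp [hab.symm, hne.symm]
      · simp [hq, hne.symm]
    · simp [hp, hp']

theorem ml (N : ℕ) : ∀ (B : SimpleGraph V), B.edgeSet.ncard = N → ∀ (I : Type) [Fintype I]
    (y x : I → V), (∀ Z : Finset V, cnt y Z ≤ cut B Z + cnt x Z) →
    ∃ π : I → I, Function.Injective π ∧ ∃ Q : I → Set (Sym2 V), (∀ i, Q i ⊆ B.edgeSet) ∧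
      (∀ i j, i ≠ j → Disjoint (Q i) (Q j)) ∧ ∀ i, Conn (Q i) (y i) (x (π i)) := by
  induction N with
  | zero =>
    intro B hB I _ y x h
    have hE : B.edgeSet = ∅ := (Set.ncard_eq_zero (Set.toFinite _)).1 hB
    have hadj : ∀ p q, ¬ B.Adj p q := by
      intro p q hpq
      have : s(p, q) ∈ B.edgeSet := hpq
      rw [hE] at this; exact this
    have hH := (Finset.all_card_le_biUnion_card_iff_exists_injective
      (fun i : I => Finset.univ.filter (fun j => x j = y i))).1 (by
        intro s
        have h1 := h (s.image y)
        have h2 : cut B (s.image y) = 0 := by simp [cut, hadj]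
        rw [h2, zero_add] at h1
        unfold cnt at h1
        rw [← Finset.card_filter, ← Finset.card_filter] at h1
        refine le_trans (Finset.card_le_card ?_) (h1.trans (Finset.card_le_card ?_))
        · intro i hi
          simp only [Finset.mem_filter, Finset.mem_univ, true_and]
          exact Finset.mem_image_of_mem y hi
        · intro j hj
          simp only [Finset.mem_filter, Finset.mem_univ, true_and, Finset.mem_image] at hj
          obtain ⟨i, hi, hij⟩ := hj
          simp only [Finset.mem_biUnion, Finset.mem_filter, Finset.mem_univ, true_and]
          exact ⟨i, hi, hij.symm⟩)
    obtain ⟨π, hπ, hx⟩ := hH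
    refine ⟨π, hπ, fun _ => ∅, by simp, by simp, ?_⟩
    intro i
    have := hx i
    simp only [Finset.mem_filter, Finset.mem_univ, true_and] at this
    rw [this]; exact Conn.refl _ _
  | succ N ih =>
    intro B hB I _ y x h
    -- the delicate step
    have step : ∀ a b : V, B.Adj a b → ∀ Z0 : Finset V, a ∈ Z0 → b ∉ Z0 →
        cut (B.deleteEdges {s(a, b)}) Z0 + cnt x Z0 < cnt y Z0 →
        (B.deleteEdges {s(a, b)}).edgeSet.ncard = N →
        ∃ π : I → I, Function.Injective π ∧ ∃ Q : I → Set (Sym2 V), (∀ i, Q i ⊆ B.edgeSet) ∧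
          (∀ i j, i ≠ j → Disjoint (Q i) (Q j)) ∧ ∀ i, Conn (Q i) (y i) (x (π i)) := by
      intro a b hab Z0 ha hb hlt hN
      obtain ⟨π, hπ, Q, hQ1, hQ2, hQ3⟩ := ih _ hN (Option I) (fun o => o.elim b y)
        (fun o => o.elim a x) (by
          intro Z
          rw [cnt_option, cnt_option]
          have e1 := cut_delete B hab Z
          have e2 := cut_delete B hab Z0
          have hZ := h Z
          by_cases haZ : a ∈ Z
          · by_cases hbZ : b ∈ Z
            · simp only [haZ, hbZ, not_true, and_false, if_false, if_true] at e1 ⊢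
              omega
            · simp [haZ, hbZ] at e1 ⊢
              omega
          · by_cases hbZ : b ∈ Z
            · have e3 := cut_delete B hab (Z ∩ Z0)
              have e4 := cut_delete B hab (Z ∪ Z0)
              have e5 := cut_submod (B.deleteEdges {s(a, b)}) Z Z0
              have e6 := cnt_mod x Z Z0
              have e7 := cnt_mod y Z Z0
              have h1 := h (Z ∩ Z0)
              have h2 := h (Z ∪ Z0)
              have h3 := h Z0
              simp [haZ, hbZ, ha, hb] at e1 e2 e3 e4 ⊢
              omega
            · simp [haZ, hbZ] at e1 ⊢
              omega)
      have hex : ∀ i, ∃ j, π (some i) = some j ∨ (π (some i) = none ∧ π none = some j) := by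
        intro i
        cases h1 : π (some i) with
        | some j => exact ⟨j, Or.inl rfl⟩
        | none =>
          cases h2 : π none with
          | some j => exact ⟨j, Or.inr ⟨rfl, rfl⟩⟩
          | none => exact absurd (hπ (h1.trans h2.symm)) (by simp)
      choose ρ hρ using hex
      have hdel : (B.deleteEdges {s(a, b)}).edgeSet ⊆ B.edgeSet :=
        edgeSet_mono (deleteEdges_le _)
      have hnot : ∀ o, s(a, b) ∉ Q o := by
        intro o ho
        have := hQ1 o ho
        simp at this
      refine ⟨ρ, ?_, fun i => if π (some i) = none then Q (some i) ∪ {s(a, b)} ∪ Q none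
        else Q (some i), ?_, ?_, ?_⟩
      · intro i j hij
        have hi := hρ i
        have hj := hρ j
        rw [hij] at hi
        rcases hi with hi | ⟨hi, hi'⟩ <;> rcases hj with hj | ⟨hj, hj'⟩
        · simpa using hπ (hi.trans hj.symm)
        · exact absurd (hπ (hi.trans hj'.symm)) (by simp)
        · exact absurd (hπ (hi'.trans hj.symm)) (by simp)
        · simpa using hπ (hi.trans hj.symm)
      · intro i
        dsimp only
        split_ifs
        · refine Set.union_subset (Set.union_subset ((hQ1 _).trans hdel) ?_) ((hQ1 _).trans hdel)
          simpa using hab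
        · exact (hQ1 _).trans hdel
      · intro i j hij
        have hij' : (some i : Option I) ≠ some j := by simpa using hij
        dsimp only
        split_ifs with h1 h2 h2
        · exact absurd (hπ (h1.trans h2.symm)) hij'
        · rw [Set.disjoint_union_left, Set.disjoint_union_left]
          exact ⟨⟨hQ2 _ _ hij', by simpa using hnot _⟩, hQ2 _ _ (by simp)⟩
        · rw [Set.disjoint_union_right, Set.disjoint_union_right]
          exact ⟨⟨hQ2 _ _ hij', by simpa using hnot _⟩, hQ2 _ _ (by simp)⟩
        · exact hQ2 _ _ hij'
      · intro i
        have h1 := hQ3 (some i)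
        have h2 := hQ3 none
        dsimp only
        rcases hρ i with hi | ⟨hi, hi'⟩
        · rw [hi] at h1 
          simpa [hi] using h1
        · rw [hi] at h1
          rw [hi'] at h2
          simp only [hi, if_true]
          have e1 : Conn (Q (some i) ∪ {s(a, b)} ∪ Q none) (y i) a :=
            Conn.mono (fun _ hz => Or.inl (Or.inl hz)) h1
          have e2 : Conn (Q (some i) ∪ {s(a, b)} ∪ Q none) b (x (ρ i)) :=
            Conn.mono (fun _ hz => Or.inr hz) h2
          exact (e1.trans (Conn.edge (Or.inl (Or.inr rfl)))).trans e2
    have hne : B.edgeSet.Nonempty := by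
      rw [← Set.ncard_pos (Set.toFinite _)]; omega
    obtain ⟨e, he⟩ := hne
    induction e using Sym2.ind with
    | _ a b =>
      have hab : B.Adj a b := he
      have hN : (B.deleteEdges {s(a, b)}).edgeSet.ncard = N := by
        rw [edgeSet_deleteEdges, Set.ncard_sdiff_singleton_of_mem he, hB]; rfl
      by_cases hc : ∀ Z : Finset V, cnt y Z ≤ cut (B.deleteEdges {s(a, b)}) Z + cnt x Z
      · obtain ⟨π, hπ, Q, hQ1, hQ2, hQ3⟩ := ih _ hN I y x hc
        exact ⟨π, hπ, Q, fun i => (hQ1 i).trans (edgeSet_mono (deleteEdges_le _)), hQ2, hQ3⟩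
      · push Not at hc
        obtain ⟨Z0, hZ0⟩ := hc
        have e1 := cut_delete B hab Z0
        have e2 := h Z0
        by_cases ha : a ∈ Z0
        · by_cases hb : b ∈ Z0
          · simp [ha, hb] at e1
            omega
          · exact step a b hab Z0 ha hb hZ0 hN
        · by_cases hb : b ∈ Z0
          · rw [Sym2.eq_swap] at hZ0 hN
            exact step b a hab.symm Z0 hb ha hZ0 hN
          · simp [ha, hb] at e1
            omega

end TOI

end

section

namespace TOI
open SimpleGraph
open scoped Classical
set_option linter.unusedSectionVars false
set_option linter.unusedVariables false
variable {V : Type*} [Fintype V]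

/-- trail with given parity inside a set of edges -/
def Link (G : SimpleGraph V) (E : Set (Sym2 V)) (q : Bool) (u v : V) : Prop :=
  ∃ p : G.Walk u v, p.IsTrail ∧ (∀ e ∈ p.edges, e ∈ E) ∧ p.length.bodd = q

theorem Link.symm {G : SimpleGraph V} {E : Set (Sym2 V)} {q : Bool} {u v : V}
    (h : Link G E q u v) : Link G E q v u := by
  obtain ⟨p, h1, h2, h3⟩ := h
  exact ⟨p.reverse, h1.reverse, by simpa using h2, by simpa using h3⟩

theorem Link.trans {G : SimpleGraph V} {E E' : Set (Sym2 V)} {q q' : Bool} {u v w : V}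
    (h : Link G E q u v) (h' : Link G E' q' v w) (hd : Disjoint E E') :
    Link G (E ∪ E') (xor q q') u w := by
  obtain ⟨p, h1, h2, h3⟩ := h
  obtain ⟨p', h1', h2', h3'⟩ := h'
  refine ⟨p.append p', ?_, ?_, ?_⟩
  · rw [Walk.isTrail_def, Walk.edges_append, List.nodup_append']
    exact ⟨h1.edges_nodup, h1'.edges_nodup, fun e he he' =>
      Set.disjoint_left.1 hd (h2 e he) (h2' e he')⟩
  · intro e he
    rw [Walk.edges_append, List.mem_append] at he
    exact he.imp (h2 e) (h2' e)
  · rw [Walk.length_append, Nat.bodd_add, h3, h3']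

theorem Link.edge {G : SimpleGraph V} {u v : V} (h : G.Adj u v) : Link G {s(u, v)} true u v := by
  refine ⟨h.toWalk, ?_, ?_, ?_⟩
  · simp [Walk.isTrail_def]
  · simp
  · simp

theorem Link.of_conn {G : SimpleGraph V} {E : Set (Sym2 V)} (hE : E ⊆ G.edgeSet) {u v : V}
    (h : Conn E u v) : ∃ q, Link G E q u v := by
  obtain ⟨p, hp⟩ := h.exists_isPath
  have hle : fromEdgeSet E ≤ G := by
    intro a b hab
    rw [fromEdgeSet_adj] at hab
    exact hE hab.1
  refine ⟨_, p.mapLe hle, ?_, ?_, rfl⟩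
  · rw [Walk.isTrail_def, Walk.edges_mapLe_eq_edges]
    exact hp.isTrail.edges_nodup
  · intro e he
    rw [Walk.edges_mapLe_eq_edges] at he
    have := p.edges_subset_edgeSet he
    rw [edgeSet_fromEdgeSet] at this
    exact this.1

theorem walk_parity {G : SimpleGraph V} (s : V → Bool) {u v : V} (p : G.Walk u v)
    (h : ∀ a b, s(a, b) ∈ p.edges → s a ≠ s b) : p.length.bodd = xor (s u) (s v) := by
  induction p with
  | nil => simp
  | @cons a b c hadj p ih =>
    have h1 := ih (fun x y hxy => h x y (by simp [hxy]))
    have h2 := h a b (by simp)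
    rw [Walk.length_cons, Nat.bodd_succ, h1]
    cases ha : s a <;> cases hb : s b <;> cases hc : s c <;> simp_all

theorem conn_color {E : Set (Sym2 V)} (s : V → Bool) (h : ∀ a b, s(a, b) ∈ E → s a = s b)
    {u v : V} (hc : Conn E u v) : s u = s v := by
  obtain ⟨p⟩ := hc
  induction p with
  | nil => rfl
  | cons hadj p ih =>
    rw [fromEdgeSet_adj] at hadj
    exact (h _ _ hadj.1).trans ih

theorem first_edge {E : Set (Sym2 V)} {u v : V} (huv : u ≠ v) (hc : Conn E u v) :
    ∃ y, y ≠ u ∧ s(u, y) ∈ E ∧ Conn (E \ {s(u, y)}) y v := by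
  obtain ⟨p, hp⟩ := hc.exists_isPath
  cases p with
  | nil => exact absurd rfl huv
  | @cons _ y _ hadj p =>
    rw [Walk.cons_isPath_iff] at hp
    have hadj' := hadj
    rw [fromEdgeSet_adj] at hadj'
    refine ⟨y, hadj'.2.symm, hadj'.1, ?_⟩
    refine ⟨p.transfer _ ?_⟩
    intro e he
    have h1 := p.edges_subset_edgeSet he
    rw [edgeSet_fromEdgeSet] at h1 ⊢
    refine ⟨⟨h1.1, ?_⟩, h1.2⟩
    intro h2
    rw [Set.mem_singleton_iff] at h2
    subst h2
    exact hp.2 (p.fst_mem_support_of_mem_edges he)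

theorem cross_edge {E : Set (Sym2 V)} {u v : V} (hc : Conn E u v) (Z : Finset V) (hu : u ∈ Z)
    (hv : v ∉ Z) : ∃ p q, p ∈ Z ∧ q ∉ Z ∧ s(p, q) ∈ E := by
  obtain ⟨p⟩ := hc
  induction p with
  | nil => exact absurd hu hv
  | @cons a b c hadj p ih =>
    rw [fromEdgeSet_adj] at hadj
    by_cases hb : b ∈ Z
    · exact ih hb hv
    · exact ⟨a, b, hu, hb, hadj.1⟩

theorem tokens_cut {D : SimpleGraph V} {I : Type} [Fintype I] {y x : I → V}
    {P : I → Set (Sym2 V)} (h1 : ∀ i, P i ⊆ D.edgeSet)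
    (h2 : ∀ i j, i ≠ j → Disjoint (P i) (P j)) (h3 : ∀ i, Conn (P i) (y i) (x i))
    (Z : Finset V) : cnt y Z ≤ cut D Z + cnt x Z := by
  have hex : ∀ i, ∃ pq : V × V, y i ∈ Z → x i ∉ Z → pq.1 ∈ Z ∧ pq.2 ∉ Z ∧ s(pq.1, pq.2) ∈ P i := by
    intro i
    by_cases hy : y i ∈ Z ∧ x i ∉ Z
    · obtain ⟨p, q, h⟩ := cross_edge (h3 i) Z hy.1 hy.2
      exact ⟨(p, q), fun _ _ => h⟩
    · exact ⟨(y i, y i), fun a b => absurd ⟨a, b⟩ hy⟩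
  choose g hg using hex
  have hcut : cut D Z = (Finset.univ.filter
      (fun pq : V × V => pq.1 ∈ Z ∧ pq.2 ∉ Z ∧ D.Adj pq.1 pq.2)).card := by
    rw [Finset.card_filter, Fintype.sum_prod_type]; rfl
  have hb : (Finset.univ.filter (fun i => y i ∈ Z ∧ x i ∉ Z)).card ≤ cut D Z := by
    rw [hcut]
    refine Finset.card_le_card_of_injOn g ?_ ?_
    · intro i hi
      simp only [Finset.coe_filter, Finset.mem_univ, true_and, Set.mem_ofPred_eq] at hi ⊢
      obtain ⟨a, b, c⟩ := hg i hi.1 hi.2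
      exact ⟨a, b, h1 i c⟩
    · intro i hi j hj hij
      simp only [Finset.coe_filter, Finset.mem_univ, true_and, Set.mem_ofPred_eq] at hi hj
      by_contra hne
      have e1 := (hg i hi.1 hi.2).2.2
      have e2 := (hg j hj.1 hj.2).2.2
      rw [hij] at e1
      exact Set.disjoint_left.1 (h2 i j hne) e1 e2
  have hle : cnt y Z ≤ (Finset.univ.filter (fun i => y i ∈ Z ∧ x i ∉ Z)).card + cnt x Z := by
    unfold cnt
    rw [Finset.card_filter, ← Finset.sum_add_distrib]
    refine Finset.sum_le_sum fun i _ => ?_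
    by_cases a : y i ∈ Z <;> by_cases b : x i ∈ Z <;> simp [a, b]
  omega

/-- edges inside the sides -/
def Dg (G : SimpleGraph V) (s : V → Bool) : SimpleGraph V where
  Adj p q := G.Adj p q ∧ s p = s q
  symm := ⟨fun _ _ h => ⟨h.1.symm, h.2.symm⟩⟩
  loopless := ⟨fun _ h => G.loopless.irrefl _ h.1⟩

/-- edges across -/
def Bg (G : SimpleGraph V) (s : V → Bool) : SimpleGraph V where
  Adj p q := G.Adj p q ∧ s p ≠ s q
  symm := ⟨fun _ _ h => ⟨h.1.symm, h.2.symm⟩⟩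
  loopless := ⟨fun _ h => G.loopless.irrefl _ h.1⟩

theorem max_cut (G : SimpleGraph V) : ∃ s : V → Bool, ∀ Z, cut (Dg G s) Z ≤ cut (Bg G s) Z := by
  let T : (V → Bool) → ℕ := fun s => ∑ p, ∑ q, if G.Adj p q ∧ s p ≠ s q then 1 else 0
  obtain ⟨s, hs⟩ := Finite.exists_max T
  refine ⟨s, fun Z => ?_⟩
  have h1 := hs (fun p => xor (decide (p ∈ Z)) (s p))
  have sw : ∀ B : SimpleGraph V, cut B Z = ∑ p, ∑ q, if q ∈ Z ∧ p ∉ Z ∧ B.Adj p q then 1 else 0 := by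
    intro B
    unfold cut
    rw [Finset.sum_comm]
    simp only [B.adj_comm]
  have key : T (fun p => xor (decide (p ∈ Z)) (s p)) + cut (Bg G s) Z + cut (Bg G s) Z =
      T s + cut (Dg G s) Z + cut (Dg G s) Z := by
    conv_lhs => rw [add_assoc]; arg 2; arg 2; rw [sw]
    conv_rhs => rw [add_assoc]; arg 2; arg 2; rw [sw]
    simp only [T]
    unfold cut
    simp only [← Finset.sum_add_distrib]
    refine Finset.sum_congr rfl fun p _ => Finset.sum_congr rfl fun q _ => ?_
    simp only [Dg, Bg]
    by_cases h1 : p ∈ Z <;> by_cases h2 : q ∈ Z <;> by_cases h3 : G.Adj p q <;>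
      rcases Bool.eq_false_or_eq_true (s p) with h4 | h4 <;>
      rcases Bool.eq_false_or_eq_true (s q) with h5 | h5 <;> simp [h1, h2, h3, h4, h5]
  omega

theorem assemble {G : SimpleGraph V} {t : ℕ} (ψ : Fin t → V) (hψ : Function.Injective ψ)
    (E : Task t → Set (Sym2 V)) (hd : ∀ p q, p ≠ q → Disjoint (E p) (E q))
    (hl : ∀ p : Task t, Link G (E p) true (ψ p.1.1) (ψ p.1.2)) :
    HasTotallyOddImmersion G (⊤ : SimpleGraph (Fin t)) := by
  choose w hw1 hw2 hw3 using hl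
  have hlt : ∀ {u v : Fin t}, (⊤ : SimpleGraph (Fin t)).Adj u v → ¬ u < v → v < u := by
    intro u v h h'
    rw [top_adj] at h
    exact lt_of_le_of_ne (not_lt.1 h') h.symm
  let tr : ∀ ⦃u v : Fin t⦄, (⊤ : SimpleGraph (Fin t)).Adj u v → G.Walk (ψ u) (ψ v) :=
    fun u v h => if h' : u < v then w ⟨(u, v), h'⟩ else (w ⟨(v, u), hlt h h'⟩).reverse
  have tr1 : ∀ (u v : Fin t) (h : (⊤ : SimpleGraph (Fin t)).Adj u v) (h' : u < v),
      tr h = w ⟨(u, v), h'⟩ := by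
    intro u v h h'
    simp only [tr, h', dif_pos]
  have tr2 : ∀ (u v : Fin t) (h : (⊤ : SimpleGraph (Fin t)).Adj u v) (h' : v < u),
      tr h = (w ⟨(v, u), h'⟩).reverse := by
    intro u v h h'
    simp only [tr, not_lt.2 h'.le, dif_neg, not_false_iff]
  have ed : ∀ (u v : Fin t) (h : (⊤ : SimpleGraph (Fin t)).Adj u v),
      ∃ p : Task t, s(p.1.1, p.1.2) = s(u, v) ∧ ∀ e ∈ (tr h).edges, e ∈ E p := by
    intro u v h
    by_cases h' : u < v
    · refine ⟨⟨(u, v), h'⟩, rfl, ?_⟩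
      rw [tr1 u v h h']
      exact hw2 _
    · refine ⟨⟨(v, u), hlt h h'⟩, Sym2.eq_swap, ?_⟩
      rw [tr2 u v h (hlt h h')]
      intro e he
      rw [Walk.edges_reverse, List.mem_reverse] at he
      exact hw2 _ e he
  refine ⟨⟨⟨ψ, hψ⟩, tr, ?_, ?_, ?_⟩, ?_⟩
  · intro u v h
    by_cases h' : u < v
    · have := hw1 ⟨(u, v), h'⟩
      rw [← tr1 u v h h'] at this; exact this
    · have := (hw1 ⟨(v, u), hlt h h'⟩).reverse
      rw [← tr2 u v h (hlt h h')] at this; exact this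
  · intro u v h
    by_cases h' : u < v
    · have e1 := tr1 u v h h'
      have e2 := tr2 v u h.symm h'
      exact e2.trans (congrArg _ e1.symm)
    · have e1 := tr2 u v h (hlt h h')
      have e2 := tr1 v u h.symm (hlt h h')
      rw [← e2] at e1
      have := congrArg Walk.reverse e1
      rw [Walk.reverse_reverse] at this
      exact this.symm
  · intro u v a b h1 h2 hne e he1 he2
    obtain ⟨p, hp, hp'⟩ := ed u v h1
    obtain ⟨q, hq, hq'⟩ := ed a b h2
    have hpq : p ≠ q := by
      intro h; subst h
      exact hne (hp.symm.trans hq)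
    exact Set.disjoint_left.1 (hd p q hpq) (hp' e he1) (hq' e he2)
  · intro u v h
    have odd : ∀ k : ℕ, k.bodd = true → Odd k := by
      intro k hk
      rw [← Nat.not_even_iff_odd, Nat.even_iff, Nat.mod_two_of_bodd, hk]
      simp
    show Odd (tr h).length
    by_cases h' : u < v
    · rw [tr1 u v h h']; exact odd _ (hw3 _)
    · rw [tr2 u v h (hlt h h'), Walk.length_reverse]; exact odd _ (hw3 _)

/-- symmetric system of links -/
structure Sys (G : SimpleGraph V) {n : ℕ} (φ : Fin n → V) (E : Fin n → Fin n → Set (Sym2 V))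
    (τ : Fin n → Fin n → Bool) : Prop where
  inj : Function.Injective φ
  es : ∀ i j, E i j = E j i
  ts : ∀ i j, τ i j = τ j i
  dis : ∀ i j k l, i ≠ j → k ≠ l → s(i, j) ≠ s(k, l) → Disjoint (E i j) (E k l)
  link : ∀ i j, i ≠ j → Link G (E i j) (τ i j) (φ i) (φ j)

theorem HasK.sys {G D : SimpleGraph V} (hle : D ≤ G) {n : ℕ} (h : HasK n D) :
    ∃ φ E τ, Sys (n := n) G φ E τ ∧ (∀ i j, i ≠ j → E i j ⊆ D.edgeSet) ∧
      ∀ i j, i ≠ j → Conn (E i j) (φ i) (φ j) := by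
  obtain ⟨φ, hφ, S, hS1, hS2, hS3⟩ := h
  have hmm : ∀ i j : Fin n, i ≠ j → min i j < max i j := fun i j h => min_lt_max.2 h
  have hc : ∀ i j, i ≠ j → Conn (S (min i j, max i j)) (φ i) (φ j) := by
    intro i j hij
    rcases lt_or_gt_of_ne hij with h | h
    · rw [min_eq_left h.le, max_eq_right h.le]; exact hS3 (i, j) h
    · rw [min_eq_right h.le, max_eq_left h.le]; exact (hS3 (j, i) h).symm
  have hsub : ∀ i j, i ≠ j → S (min i j, max i j) ⊆ D.edgeSet := fun i j hij =>
    hS1 (min i j, max i j) (hmm i j hij)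
  have hτ : ∀ i j, ∃ q, i ≠ j → Link G (S (min i j, max i j)) q (φ i) (φ j) := by
    intro i j
    by_cases hij : i = j
    · exact ⟨true, fun h => absurd hij h⟩
    · obtain ⟨q, hq⟩ := Link.of_conn ((hsub i j hij).trans (edgeSet_mono hle)) (hc i j hij)
      exact ⟨q, fun _ => hq⟩
  choose τ hτ using hτ
  refine ⟨φ, fun i j => S (min i j, max i j), fun i j => τ (min i j) (max i j),
    ⟨hφ, ?_, ?_, ?_, ?_⟩, hsub, hc⟩
  · intro i j; simp only [min_comm, max_comm]
  · intro i j; simp only [min_comm, max_comm]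
  · intro i j k l hij hkl hne
    refine hS2 _ _ (hmm i j hij) (hmm k l hkl) ?_
    intro heq
    rw [Prod.mk.injEq] at heq
    apply hne
    rcases lt_or_gt_of_ne hij with h | h <;> rcases lt_or_gt_of_ne hkl with h' | h' <;>
      simp only [min_eq_left, max_eq_right, min_eq_right, max_eq_left, h.le, h'.le] at heq <;>
      simp [heq.1, heq.2, Sym2.eq_swap]
  · intro i j hij
    have h1 := hτ (min i j) (max i j) (hmm i j hij).ne
    rcases lt_or_gt_of_ne hij with h | h
    · simp only [min_eq_left h.le, max_eq_right h.le] at h1 ⊢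
      exact h1
    · simp only [min_eq_right h.le, max_eq_left h.le, min_eq_left h.le, max_eq_right h.le] at h1 ⊢
      exact h1.symm

end TOI

end

section

namespace TOI
open SimpleGraph
open scoped Classical
set_option linter.unusedSectionVars false
set_option linter.unusedVariables false
variable {V : Type*} [Fintype V]

theorem Link.mono {G : SimpleGraph V} {E E' : Set (Sym2 V)} (h : E ⊆ E') {q : Bool} {u v : V}
    (hl : Link G E q u v) : Link G E' q u v := by
  obtain ⟨p, h1, h2, h3⟩ := hl
  exact ⟨p, h1, fun e he => h (h2 e he), h3⟩

theorem Link.parity {G : SimpleGraph V} {E : Set (Sym2 V)} {q : Bool} {u v : V}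
    (hl : Link G E q u v) (s : V → Bool) (h : ∀ a b, s(a, b) ∈ E → s a ≠ s b) :
    q = xor (s u) (s v) := by
  obtain ⟨p, h1, h2, h3⟩ := hl
  rw [← h3]
  exact walk_parity s p (fun a b hab => h a b (h2 _ hab))

/-- union of the links of a set of pairs -/
def span {n : ℕ} (E : Fin n → Fin n → Set (Sym2 V)) (T : Set (Sym2 (Fin n))) : Set (Sym2 V) :=
  {e | ∃ i j, i ≠ j ∧ s(i, j) ∈ T ∧ e ∈ E i j}

theorem subset_span {n : ℕ} {E : Fin n → Fin n → Set (Sym2 V)} {T : Set (Sym2 (Fin n))}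
    {i j : Fin n} (hij : i ≠ j) (h : s(i, j) ∈ T) : E i j ⊆ span E T :=
  fun _ he => ⟨i, j, hij, h, he⟩

theorem span_disjoint {G : SimpleGraph V} {n : ℕ} {φ : Fin n → V}
    {E : Fin n → Fin n → Set (Sym2 V)} {τ : Fin n → Fin n → Bool} (S : Sys G φ E τ)
    {T T' : Set (Sym2 (Fin n))} (h : ∀ e, ¬ e.IsDiag → e ∈ T → e ∉ T') :
    Disjoint (span E T) (span E T') := by
  rw [Set.disjoint_left]
  rintro e ⟨i, j, hij, hT, he⟩ ⟨k, l, hkl, hT', he'⟩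
  refine Set.disjoint_left.1 (S.dis i j k l hij hkl ?_) he he'
  intro heq
  rw [← heq] at hT'
  exact h _ (by simpa using hij) hT hT'

theorem case1_cand {t n : ℕ} (ht : 1 ≤ t) (hn : n = 181 * t) (τ : Fin n → Fin n → Bool)
    (hodd : ∀ Y : Finset (Fin n), Y.card = 45 * t →
      (45 * t) ^ 2 < 5 * ((Y ×ˢ Y).filter (fun c => c.1 ≠ c.2 ∧ τ c.1 c.2 = true)).card)
    (u v : Fin n) : ∃ C : Finset (Fin n × Fin n), ∃ M k : ℕ,
      (∀ c ∈ C, t ≤ c.1.val ∧ t ≤ c.2.val ∧ ((c.1 = c.2 ∧ τ u c.1 ≠ τ v c.1) ∨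
        (c.1 ≠ c.2 ∧ τ c.1 c.2 = true ∧ τ u c.1 = τ v c.2))) ∧
      (∀ x, (C.filter (fun c => c.1 = x)).card ≤ M) ∧
      (∀ x, (C.filter (fun c => c.2 = x)).card ≤ M) ∧
      (∀ e : Sym2 (Fin n), ¬ e.IsDiag → (C.filter (fun c => s(c.1, c.2) = e)).card ≤ k) ∧
      4 * t * M + k * t ^ 2 < C.card := by
  let W : Finset (Fin n) := Finset.univ.filter (fun i => ¬ i.val < t)
  have hW : 180 * t ≤ W.card := by
    have h1 := Finset.card_filter_add_card_filter_not (s := (Finset.univ : Finset (Fin n)))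
      (fun i => i.val < t)
    have h2 : (Finset.univ.filter (fun i : Fin n => i.val < t)).card ≤ (Finset.range t).card := by
      refine Finset.card_le_card_of_injOn (fun i => i.val) ?_ ?_
      · intro i hi; simpa using hi
      · intro i _ j _ h; exact Fin.ext h
    rw [Finset.card_range] at h2
    have h3 : (Finset.univ : Finset (Fin n)).card = n := by simp
    have h4 : W.card = (Finset.univ.filter (fun i : Fin n => ¬ i.val < t)).card := rfl
    omega
  obtain ⟨c, -, hc⟩ := Finset.exists_le_card_fiber_of_mul_le_card_of_maps_to (s := W)
    (t := (Finset.univ : Finset (Bool × Bool))) (f := fun w => (τ u w, τ v w)) (n := 45 * t)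
    (by simp) (by simp) (by simp; omega)
  obtain ⟨Y, hYs, hY⟩ := Finset.exists_subset_card_eq hc
  have hYm : ∀ w ∈ Y, t ≤ w.val ∧ τ u w = c.1 ∧ τ v w = c.2 := by
    intro w hw
    have := hYs hw
    simp only [W, Finset.mem_filter, Finset.mem_univ, true_and] at this
    exact ⟨by omega, by rw [← this.2], by rw [← this.2]⟩
  by_cases hcc : c.1 = c.2
  · refine ⟨(Y ×ˢ Y).filter (fun c => c.1 ≠ c.2 ∧ τ c.1 c.2 = true), 45 * t, 2, ?_, ?_, ?_, ?_, ?_⟩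
    · intro w hw
      rw [Finset.mem_filter, Finset.mem_product] at hw
      have h1 := hYm _ hw.1.1
      have h2 := hYm _ hw.1.2
      refine ⟨h1.1, h2.1, Or.inr ⟨hw.2.1, hw.2.2, ?_⟩⟩
      rw [h1.2.1, h2.2.2, hcc]
    · intro x
      rw [← hY]
      refine Finset.card_le_card_of_injOn (fun c => c.2) ?_ ?_
      · intro w hw
        simp only [Finset.coe_filter, Finset.mem_filter, Finset.mem_product, Set.mem_ofPred_eq] at hw
        exact hw.1.1.2
      · intro w hw w' hw' h
        simp only [Finset.coe_filter, Finset.mem_filter, Finset.mem_product, Set.mem_ofPred_eq]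
          at hw hw'
        exact Prod.ext (hw.2.trans hw'.2.symm) h
    · intro x
      rw [← hY]
      refine Finset.card_le_card_of_injOn (fun c => c.1) ?_ ?_
      · intro w hw
        simp only [Finset.coe_filter, Finset.mem_filter, Finset.mem_product, Set.mem_ofPred_eq] at hw
        exact hw.1.1.1
      · intro w hw w' hw' h
        simp only [Finset.coe_filter, Finset.mem_filter, Finset.mem_product, Set.mem_ofPred_eq]
          at hw hw'
        exact Prod.ext h (hw.2.trans hw'.2.symm)
    · intro e he
      induction e using Sym2.ind with
      | _ a b =>
        refine le_trans (Finset.card_le_card (t := {(a, b), (b, a)}) ?_) (Finset.card_le_two)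
        intro w hw
        rw [Finset.mem_filter] at hw
        have := hw.2
        rw [Sym2.eq_iff] at this
        simp only [Finset.mem_insert, Finset.mem_singleton]
        exact this.imp (fun h => Prod.ext h.1 h.2) (fun h => Prod.ext h.1 h.2)
    · have := hodd Y hY
      nlinarith
  · refine ⟨Y.image (fun w => (w, w)), 1, 0, ?_, ?_, ?_, ?_, ?_⟩
    · intro w hw
      rw [Finset.mem_image] at hw
      obtain ⟨a, ha, rfl⟩ := hw
      have h1 := hYm a ha
      refine ⟨h1.1, h1.1, Or.inl ⟨rfl, ?_⟩⟩
      dsimp only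
      rw [h1.2.1, h1.2.2]; exact hcc
    · intro x
      rw [Finset.card_le_one]
      intro a ha b hb
      simp only [Finset.mem_filter, Finset.mem_image] at ha hb
      grind
    · intro x
      rw [Finset.card_le_one]
      intro a ha b hb
      simp only [Finset.mem_filter, Finset.mem_image] at ha hb
      grind
    · intro e he
      rw [Nat.le_zero, Finset.card_eq_zero, Finset.filter_eq_empty_iff]
      intro w hw h
      rw [Finset.mem_image] at hw
      obtain ⟨a, ha, rfl⟩ := hw
      rw [← h] at he
      simp at he
    · rw [Finset.card_image_of_injective _ (fun a b h => (Prod.mk.inj h).1), hY]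
      omega

theorem card_task_le (t : ℕ) : Fintype.card (Task t) ≤ t ^ 2 := by
  have := Fintype.card_subtype_le (fun p : Fin t × Fin t => p.1 < p.2)
  rw [Fintype.card_prod, Fintype.card_fin] at this
  unfold Task
  rw [sq]
  convert this

theorem case1 {G : SimpleGraph V} {t n : ℕ} (ht : 1 ≤ t) (hn : n = 181 * t) {φ : Fin n → V}
    {E : Fin n → Fin n → Set (Sym2 V)} {τ : Fin n → Fin n → Bool} (S : Sys G φ E τ)
    (hodd : ∀ Y : Finset (Fin n), Y.card = 45 * t →
      (45 * t) ^ 2 < 5 * ((Y ×ˢ Y).filter (fun c => c.1 ≠ c.2 ∧ τ c.1 c.2 = true)).card) :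
    HasTotallyOddImmersion G (⊤ : SimpleGraph (Fin t)) := by
  have hle : t ≤ n := by omega
  let ι : Fin t → Fin n := Fin.castLE hle
  have hι : Function.Injective ι := Fin.castLE_injective hle
  have hιlt : ∀ i, (ι i).val < t := fun i => i.2
  have hcand := fun p : Task t => case1_cand ht hn τ hodd (ι p.1.1) (ι p.1.2)
  choose C M k hC1 hC2 hC3 hC4 hC5 using hcand
  let T : Task t → Fin n × Fin n → Set (Sym2 (Fin n)) := fun p c =>
    {s(ι p.1.1, c.1), s(c.1, c.2), s(c.2, ι p.1.2)}
  obtain ⟨c, hc, hR⟩ := greedy (ι := Task t) (γ := Fin n × Fin n) C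
    (fun p c q d => ∃ e, ¬ e.IsDiag ∧ e ∈ T p c ∧ e ∈ T q d)
    (by rintro p c q d ⟨e, h1, h2, h3⟩; exact ⟨e, h1, h3, h2⟩)
    (fun p q => M p * ((if q.1.1 = p.1.1 then 1 else 0) + (if q.1.2 = p.1.1 then 1 else 0) +
      (if q.1.1 = p.1.2 then 1 else 0) + (if q.1.2 = p.1.2 then 1 else 0)) + k p)
    (by
      intro p q hpq d hd
      have hd1 := (hC1 q d hd).1
      have hd2 := (hC1 q d hd).2.1
      have hsub : (C p).filter (fun c => ∃ e, ¬ e.IsDiag ∧ e ∈ T p c ∧ e ∈ T q d) ⊆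
          (if q.1.1 = p.1.1 then (C p).filter (fun c => c.1 = d.1) else ∅) ∪
          (if q.1.2 = p.1.1 then (C p).filter (fun c => c.1 = d.2) else ∅) ∪
          (if q.1.1 = p.1.2 then (C p).filter (fun c => c.2 = d.1) else ∅) ∪
          (if q.1.2 = p.1.2 then (C p).filter (fun c => c.2 = d.2) else ∅) ∪
          (if ¬ s(d.1, d.2).IsDiag then (C p).filter (fun c => s(c.1, c.2) = s(d.1, d.2))
            else ∅) := by
        intro c hc
        rw [Finset.mem_filter] at hc
        obtain ⟨hcC, e, hed, he1, he2⟩ := hc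
        have hc1 := (hC1 p c hcC).1
        have hc2 := (hC1 p c hcC).2.1
        have n1 : ∀ i, ι i ≠ c.1 := fun i h => by have := hιlt i; rw [h] at this; omega
        have n2 : ∀ i, ι i ≠ c.2 := fun i h => by have := hιlt i; rw [h] at this; omega
        have n3 : ∀ i, ι i ≠ d.1 := fun i h => by have := hιlt i; rw [h] at this; omega
        have n4 : ∀ i, ι i ≠ d.2 := fun i h => by have := hιlt i; rw [h] at this; omega
        have i1 : ∀ i j, ι i = ι j → i = j := fun i j h => hι h
        simp only [T, Set.mem_insert_iff, Set.mem_singleton_iff] at he1 he2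
        simp only [Finset.mem_union]
        rcases he1 with rfl | rfl | rfl <;> rcases he2 with he2 | he2 | he2
        · have hh : q.1.1 = p.1.1 ∧ c.1 = d.1 := by grind
          left; left; left; left
          simp [hh, hcC]
        · exfalso; grind
        · have hh : q.1.2 = p.1.1 ∧ c.1 = d.2 := by grind
          left; left; left; right
          simp [hh, hcC]
        · exfalso; grind
        · right
          rw [he2] at hed
          rw [if_pos hed, Finset.mem_filter]
          exact ⟨hcC, he2⟩
        · exfalso; grind
        · have hh : q.1.1 = p.1.2 ∧ c.2 = d.1 := by grind
          left; left; right
          simp [hh, hcC]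
        · exfalso; grind
        · have hh : q.1.2 = p.1.2 ∧ c.2 = d.2 := by grind
          left; right
          simp [hh, hcC]
      have b1 : ∀ (P : Prop) [Decidable P] (A : Finset (Fin n × Fin n)) (m : ℕ), A.card ≤ m →
          (if P then A else ∅).card ≤ m * (if P then 1 else 0) := by
        intro P _ A m h
        by_cases hP : P <;> simp [hP, h]
      have e1 := b1 (q.1.1 = p.1.1) _ _ (hC2 p d.1)
      have e2 := b1 (q.1.2 = p.1.1) _ _ (hC2 p d.2)
      have e3 := b1 (q.1.1 = p.1.2) _ _ (hC3 p d.1)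
      have e4 := b1 (q.1.2 = p.1.2) _ _ (hC3 p d.2)
      have e5 : (if ¬ s(d.1, d.2).IsDiag then (C p).filter (fun c => s(c.1, c.2) = s(d.1, d.2))
            else ∅).card ≤ k p := by
        split_ifs with h
        · simp
        · exact hC4 p _ h
      refine (Finset.card_le_card (fun c hc =>
        hsub (by simp only [Finset.mem_filter] at hc ⊢; exact hc))).trans ?_
      refine (Finset.card_union_le _ _).trans (add_le_add ?_ e5)
      refine (Finset.card_union_le _ _).trans ?_
      rw [mul_add]
      refine add_le_add ?_ e4
      refine (Finset.card_union_le _ _).trans ?_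
      rw [mul_add]
      refine add_le_add ?_ e3
      refine (Finset.card_union_le _ _).trans ?_
      rw [mul_add]
      exact add_le_add e1 e2)
    (by
      intro p
      refine lt_of_le_of_lt ?_ (hC5 p)
      rw [Finset.sum_add_distrib, ← Finset.mul_sum]
      simp only [Finset.sum_add_distrib, ← Finset.card_filter, Finset.sum_const, smul_eq_mul]
      have h4 := card_fst (n := t) p.1.1
      have h5 := card_fst (n := t) p.1.2
      have h6 := card_snd (n := t) p.1.1
      have h7 := card_snd (n := t) p.1.2
      have h8 := card_task_le t
      rw [Finset.card_univ]
      refine add_le_add ?_ ?_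
      · rw [mul_comm]
        refine Nat.mul_le_mul_right _ ?_
        omega
      · rw [mul_comm]
        refine Nat.mul_le_mul_left _ ?_
        convert h8)
  refine assemble (fun i => φ (ι i)) (S.inj.comp hι) (fun p => span E (T p (c p))) ?_ ?_
  · intro p q hpq
    refine span_disjoint S ?_
    intro e he h1 h2
    exact hR p q hpq ⟨e, he, h1, h2⟩
  · intro p
    obtain ⟨h1, h2, h3⟩ := hC1 p (c p) (hc p)
    have n1 : ∀ i, ι i ≠ (c p).1 := fun i h => by have := hιlt i; rw [h] at this; omega
    have n2 : ∀ i, ι i ≠ (c p).2 := fun i h => by have := hιlt i; rw [h] at this; omega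
    have n3 : ι p.1.1 ≠ ι p.1.2 := fun h => p.2.ne (hι h)
    rcases h3 with ⟨h3, h4⟩ | ⟨h3, h4, h5⟩
    · have l := (S.link _ _ (n1 p.1.1)).trans (S.link _ _ (n1 p.1.2).symm)
        (S.dis _ _ _ _ (n1 _) (n1 _).symm (by
          have := n1 p.1.1
          grind))
      rw [S.ts (c p).1 (ι p.1.2)] at l
      have hx : xor (τ (ι p.1.1) (c p).1) (τ (ι p.1.2) (c p).1) = true := by
        simpa using h4
      rw [hx] at l
      refine l.mono (Set.union_subset (subset_span (n1 _) ?_) (subset_span (n1 _).symm ?_))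
      · simp [T]
      · simp [T, ← h3]
    · have l := ((S.link _ _ (n1 p.1.1)).trans (S.link _ _ h3)
        (S.dis _ _ _ _ (n1 _) h3 (by
          have := n1 p.1.1
          have := n2 p.1.1
          grind))).trans (S.link _ _ (n2 p.1.2).symm) (by
            rw [Set.disjoint_union_left]
            have a1 := n1 p.1.1
            have a2 := n2 p.1.1
            have a3 := n1 p.1.2
            have a4 := n2 p.1.2
            exact ⟨S.dis _ _ _ _ (n1 _) (n2 _).symm (by grind),
              S.dis _ _ _ _ h3 (n2 _).symm (by grind)⟩)
      rw [S.ts (c p).2 (ι p.1.2), h5, h4] at l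
      have hx : xor (xor (τ (ι p.1.2) (c p).2) true) (τ (ι p.1.2) (c p).2) = true := by
        cases τ (ι p.1.2) (c p).2 <;> rfl
      rw [hx] at l
      refine l.mono (Set.union_subset (Set.union_subset (subset_span (n1 _) ?_)
        (subset_span h3 ?_)) (subset_span (n2 _).symm ?_)) <;> simp [T]

end TOI

end

section

namespace TOI
open SimpleGraph
open scoped Classical
set_option linter.unusedSectionVars false
set_option linter.unusedVariables false
variable {V : Type*} [Fintype V]

theorem sne {α : Type*} {a b c d : α} (h1 : a ≠ c ∨ b ≠ d) (h2 : a ≠ d ∨ b ≠ c) :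
    s(a, b) ≠ s(c, d) := by
  rw [Ne, Sym2.eq_iff]
  tauto

theorem tdis {n t : ℕ} {U R : Fin t → Fin n} (hU : ∀ a b, U a = U b → a = b)
    (hR : ∀ a b, R a = R b → a = b) (hUR : ∀ a b, U a ≠ R b) {u v z u' v' z' : Fin t}
    {c c' : Fin n} (a1 : ∀ a, U a ≠ c) (a2 : ∀ a, R a ≠ c) (a3 : ∀ a, U a ≠ c')
    (a4 : ∀ a, R a ≠ c') (a5 : ¬ (c = c' ∧ (z = z' ∨ v = v'))) (a6 : ¬ (u = u' ∧ v = v'))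
    {e : Sym2 (Fin n)} (he1 : e = s(U u, R v) ∨ e = s(R z, c) ∨ e = s(c, U v))
    (he2 : e = s(U u', R v') ∨ e = s(R z', c') ∨ e = s(c', U v')) : False := by
  rcases he1 with rfl | rfl | rfl <;> rcases he2 with he2 | he2 | he2 <;>
    rw [Sym2.eq_iff] at he2 <;> rcases he2 with ⟨h1, h2⟩ | ⟨h1, h2⟩ <;> grind

theorem case2 {G : SimpleGraph V} {s : V → Bool} (hcut : ∀ Z, cut (Dg G s) Z ≤ cut (Bg G s) Z)
    {t n : ℕ} (ht : 1 ≤ t) {φ : Fin n → V}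
    {E : Fin n → Fin n → Set (Sym2 V)} {τ : Fin n → Fin n → Bool} (S : Sys G φ E τ)
    (hE : ∀ i j, i ≠ j → E i j ⊆ (Dg G s).edgeSet)
    (hconn : ∀ i j, i ≠ j → Conn (E i j) (φ i) (φ j))
    (Y : Finset (Fin n)) (hY : Y.card = 45 * t)
    (hodd : 5 * ((Y ×ˢ Y).filter (fun c => c.1 ≠ c.2 ∧ τ c.1 c.2 = true)).card ≤ (45 * t) ^ 2) :
    HasTotallyOddImmersion G (⊤ : SimpleGraph (Fin t)) := by
  -- vertices with few odd links
  let od : Fin n → ℕ := fun a => (Y.filter (fun b => a ≠ b ∧ τ a b = true)).card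
  have hsum : ((Y ×ˢ Y).filter (fun c => c.1 ≠ c.2 ∧ τ c.1 c.2 = true)).card = ∑ a ∈ Y, od a := by
    rw [Finset.card_filter, Finset.sum_product]
    refine Finset.sum_congr rfl fun a _ => ?_
    simp only [od, Finset.card_filter]
  have hgood : t + t ≤ (Y.filter (fun a => od a ≤ 18 * t)).card := by
    have h1 := Finset.card_filter_add_card_filter_not (s := Y) (fun a => od a ≤ 18 * t)
    have h2 : (Y.filter (fun a => ¬ od a ≤ 18 * t)).card * (18 * t) ≤ ∑ a ∈ Y, od a := by
      have h3 := Finset.card_nsmul_le_sum (Y.filter (fun a => ¬ od a ≤ 18 * t)) od (18 * t) (by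
        intro a ha
        rw [Finset.mem_filter] at ha
        omega)
      rw [smul_eq_mul] at h3
      exact h3.trans (Finset.sum_le_sum_of_subset (Finset.filter_subset _ _))
    by_contra hlt
    have h4 : 43 * t ≤ (Y.filter (fun a => ¬ od a ≤ 18 * t)).card := by omega
    have h5 := Nat.mul_le_mul_right (18 * t) h4
    rw [hsum] at hodd
    nlinarith
  obtain ⟨ψ, hψ, hψm⟩ := exists_fin_of_card hgood
  simp only [Finset.mem_filter] at hψm
  let U : Fin t → Fin n := fun u => ψ (Fin.castAdd t u)
  let R : Fin t → Fin n := fun u => ψ (Fin.natAdd t u)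
  have hU : ∀ a b, U a = U b → a = b := fun a b h => Fin.castAdd_injective t t (hψ h)
  have hR : ∀ a b, R a = R b → a = b := fun a b h => Fin.natAdd_injective t t (hψ h)
  have hUR : ∀ a b, U a ≠ R b := by
    intro a b h
    have h1 := congrArg Fin.val (hψ h)
    simp only [Fin.val_castAdd, Fin.val_natAdd] at h1
    have := a.2
    omega
  have hUod : ∀ a, od (U a) ≤ 18 * t := fun a => (hψm _).2
  have hRod : ∀ a, od (R a) ≤ 18 * t := fun a => (hψm _).2
  let Y' : Finset (Fin n) := Y \ Finset.univ.image ψ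
  have hY' : 43 * t ≤ Y'.card := by
    have h1 := Finset.le_card_sdiff (Finset.univ.image ψ) Y
    have h2 := Finset.card_image_le (s := Finset.univ) (f := ψ)
    rw [Finset.card_univ, Fintype.card_fin] at h2
    have h3 : Y'.card = (Y \ Finset.univ.image ψ).card := rfl
    omega
  have hY'U : ∀ c ∈ Y', ∀ a, U a ≠ c := by
    intro c hc a h
    exact (Finset.mem_sdiff.1 hc).2 (Finset.mem_image.2 ⟨_, Finset.mem_univ _, h⟩)
  have hY'R : ∀ c ∈ Y', ∀ a, R a ≠ c := by
    intro c hc a h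
    exact (Finset.mem_sdiff.1 hc).2 (Finset.mem_image.2 ⟨_, Finset.mem_univ _, h⟩)
  -- colours
  have hDs : ∀ a b, s(a, b) ∈ (Dg G s).edgeSet → s a = s b := fun a b h => h.2
  have hBs : ∀ a b, s(a, b) ∈ (Bg G s).edgeSet → s a ≠ s b := fun a b h => h.2
  have hφs : ∀ i j, s (φ i) = s (φ j) := by
    intro i j
    by_cases hij : i = j
    · rw [hij]
    · exact conn_color s (fun a b h => hDs a b (hE i j hij h)) (hconn i j hij)
  -- tokens
  have hfe : ∀ i : Fin t × Fin t, ∃ y, y ≠ φ (U i.1) ∧ s(φ (U i.1), y) ∈ E (U i.1) (R i.2) ∧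
      Conn (E (U i.1) (R i.2) \ {s(φ (U i.1), y)}) y (φ (R i.2)) := fun i =>
    first_edge (fun h => hUR _ _ (S.inj h)) (hconn _ _ (hUR _ _))
  choose y hy1 hy2 hy3 using hfe
  have hpair : ∀ i j : Fin t × Fin t, i ≠ j → Disjoint (E (U i.1) (R i.2)) (E (U j.1) (R j.2)) := by
    intro i j hij
    refine S.dis _ _ _ _ (hUR _ _) (hUR _ _) ?_
    intro h
    rw [Sym2.eq_iff] at h
    rcases h with h | h
    · exact hij (Prod.ext (hU _ _ h.1) (hR _ _ h.2))
    · exact hUR _ _ h.1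
  obtain ⟨π, hπ, Q, hQ1, hQ2, hQ3⟩ := ml _ (Bg G s) rfl (Fin t × Fin t) y (fun i => φ (R i.2)) (by
    intro Z
    have := tokens_cut (D := Dg G s) (y := y) (x := fun i => φ (R i.2))
      (P := fun i => E (U i.1) (R i.2) \ {s(φ (U i.1), y i)})
      (fun i => Set.sdiff_subset.trans (hE _ _ (hUR _ _)))
      (fun i j hij => (hpair i j hij).mono Set.sdiff_subset Set.sdiff_subset) hy3 Z
    have := hcut Z
    omega)
  have hQl : ∀ i, Link G (Q i) false (y i) (φ (R (π i).2)) := by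
    intro i
    have hBG : (Bg G s).edgeSet ⊆ G.edgeSet := edgeSet_mono (fun a b h => h.1)
    obtain ⟨q, hq⟩ := Link.of_conn ((hQ1 i).trans hBG) (hQ3 i)
    have h1 := hq.parity s (fun a b h => hBs a b (hQ1 i h))
    have h2 := hDs _ _ (hE _ _ (hUR _ _) (hy2 i))
    rw [← h2, hφs (U i.1) (R (π i).2)] at h1
    simp only [bne_self_eq_false] at h1
    rw [← h1]; exact hq
  have hBD : ∀ A B : Set (Sym2 V), A ⊆ (Bg G s).edgeSet → B ⊆ (Dg G s).edgeSet → Disjoint A B := by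
    intro A B hA hB
    rw [Set.disjoint_left]
    intro e h1 h2
    have h1 := hA h1
    have h2 := hB h2
    induction e using Sym2.ind with
    | _ a b => exact hBs a b h1 (hDs a b h2)
  -- last links
  let z : Task t → Fin t := fun p => (π p.1).2
  have hz : ∀ p, (Finset.univ.filter (fun q : Task t => z p = z q)).card ≤ t := by
    intro p
    have h1 : (Finset.univ.filter (fun q : Task t => z p = z q)).card ≤
        (Finset.univ : Finset (Fin t)).card := by
      refine Finset.card_le_card_of_injOn (fun q => (π q.1).1) (by intro _ _; simp) ?_
      intro q hq q' hq' h
      simp only [Finset.coe_filter, Finset.mem_univ, true_and, Set.mem_ofPred_eq] at hq hq'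
      exact Subtype.ext (hπ (Prod.ext h (hq.symm.trans hq')))
    simpa using h1
  obtain ⟨c, hc, hcR⟩ := greedy (ι := Task t) (γ := Fin n)
    (fun p => Y'.filter (fun c => τ (R (z p)) c = false ∧ τ (U p.1.2) c = false))
    (fun p c q d => c = d ∧ (z p = z q ∨ p.1.2 = q.1.2))
    (by rintro p c q d ⟨h1, h2⟩; exact ⟨h1.symm, h2.imp Eq.symm Eq.symm⟩)
    (fun p q => (if z p = z q then 1 else 0) + (if q.1.2 = p.1.2 then 1 else 0))
    (by
      intro p q hpq d hd
      by_cases h : z p = z q ∨ p.1.2 = q.1.2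
      · have h1 : 1 ≤ (if z p = z q then 1 else 0) + (if q.1.2 = p.1.2 then 1 else 0) := by
          rcases h with h | h
          · simp [h]
          · simp [h]
        refine le_trans ?_ h1
        rw [Finset.card_le_one]
        intro a ha b hb
        simp only [Finset.mem_filter] at ha hb
        exact ha.2.1.trans hb.2.1.symm
      · rw [Finset.card_eq_zero.2]
        · exact Nat.zero_le _
        · refine Finset.eq_empty_of_forall_notMem fun a ha => ?_
          simp only [Finset.mem_filter] at ha
          exact h ha.2.2)
    (by
      intro p
      simp only [Finset.sum_add_distrib, ← Finset.card_filter]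
      have h1 := hz p
      have h2 := card_snd (n := t) p.1.2
      have hsub : Y' ⊆ (Y'.filter (fun c => τ (R (z p)) c = false ∧ τ (U p.1.2) c = false)) ∪
          ((Y.filter (fun b => R (z p) ≠ b ∧ τ (R (z p)) b = true)) ∪
          (Y.filter (fun b => U p.1.2 ≠ b ∧ τ (U p.1.2) b = true))) := by
        intro b hb
        have hbY : b ∈ Y := (Finset.mem_sdiff.1 hb).1
        have n1 := hY'U b hb p.1.2
        have n2 := hY'R b hb (z p)
        simp only [Finset.mem_union, Finset.mem_filter]
        cases h3 : τ (R (z p)) b <;> cases h4 : τ (U p.1.2) b <;> simp [hb, hbY, n1, n2]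
      have h3 := Finset.card_le_card hsub
      have h4 := Finset.card_union_le (Y'.filter (fun c => τ (R (z p)) c = false ∧
        τ (U p.1.2) c = false)) ((Y.filter (fun b => R (z p) ≠ b ∧ τ (R (z p)) b = true)) ∪
          (Y.filter (fun b => U p.1.2 ≠ b ∧ τ (U p.1.2) b = true)))
      have h5 := Finset.card_union_le (Y.filter (fun b => R (z p) ≠ b ∧ τ (R (z p)) b = true))
          (Y.filter (fun b => U p.1.2 ≠ b ∧ τ (U p.1.2) b = true))
      have h6 : (Y.filter (fun b => R (z p) ≠ b ∧ τ (R (z p)) b = true)).card ≤ 18 * t := hRod _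
      have h7 : (Y.filter (fun b => U p.1.2 ≠ b ∧ τ (U p.1.2) b = true)).card ≤ 18 * t := hUod _
      omega)
  have hcY : ∀ p, c p ∈ Y' := fun p => (Finset.mem_filter.1 (hc p)).1
  have hcτ : ∀ p, τ (R (z p)) (c p) = false ∧ τ (U p.1.2) (c p) = false :=
    fun p => (Finset.mem_filter.1 (hc p)).2
  let X : Task t → Set (Sym2 V) := fun p =>
    {s(φ (U p.1.1), y p.1)} ∪ E (R (z p)) (c p) ∪ E (c p) (U p.1.2)
  have hXD : ∀ p, X p ⊆ (Dg G s).edgeSet := by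
    intro p
    refine Set.union_subset (Set.union_subset ?_ (hE _ _ (hY'R _ (hcY p) _)))
      (hE _ _ (hY'U _ (hcY p) _).symm)
    rw [Set.singleton_subset_iff]
    exact hE _ _ (hUR _ _) (hy2 p.1)
  have hXs : ∀ p, X p ⊆ span E {s(U p.1.1, R p.1.2), s(R (z p), c p), s(c p, U p.1.2)} := by
    intro p
    refine Set.union_subset (Set.union_subset ?_ (subset_span (hY'R _ (hcY p) _) (by simp)))
      (subset_span (hY'U _ (hcY p) _).symm (by simp))
    rw [Set.singleton_subset_iff]
    exact subset_span (hUR _ _) (by simp) (hy2 p.1)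
  refine assemble (fun i => φ (U i)) (fun a b h => hU a b (S.inj h))
    (fun p => X p ∪ Q p.1) ?_ ?_
  · intro p q hpq
    have hpq' : p.1 ≠ q.1 := fun h => hpq (Subtype.ext h)
    refine Set.disjoint_union_left.2 ⟨Set.disjoint_union_right.2
      ⟨?_, (hBD _ _ (hQ1 _) (hXD p)).symm⟩, Set.disjoint_union_right.2
      ⟨hBD _ _ (hQ1 _) (hXD q), hQ2 _ _ hpq'⟩⟩
    refine (span_disjoint S ?_).mono (hXs p) (hXs q)
    intro e _ he1 he2
    have a6 : ¬ (p.1.1 = q.1.1 ∧ p.1.2 = q.1.2) := fun h => hpq' (Prod.ext h.1 h.2)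
    simp only [Set.mem_insert_iff, Set.mem_singleton_iff] at he1 he2
    exact tdis hU hR hUR (hY'U _ (hcY p)) (hY'R _ (hcY p)) (hY'U _ (hcY q)) (hY'R _ (hcY q))
      (hcR p q hpq) a6 he1 he2
  · intro p
    have hfD : ({s(φ (U p.1.1), y p.1)} : Set (Sym2 V)) ⊆ (Dg G s).edgeSet := by
      rw [Set.singleton_subset_iff]
      exact hE _ _ (hUR _ _) (hy2 p.1)
    have hadj : G.Adj (φ (U p.1.1)) (y p.1) := (hfD rfl).1
    have b1 := hY'R _ (hcY p) (z p)
    have b2 := hY'U _ (hcY p) p.1.2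
    have b3 := hY'R _ (hcY p) p.1.2
    have b4 := hY'U _ (hcY p) p.1.1
    have b5 := hUR p.1.1 (z p)
    have b6 := hUR p.1.2 (z p)
    have l1 := (Link.edge hadj).trans (hQl p.1) (hBD _ _ (hQ1 _) hfD).symm
    have l2 := S.link _ _ b1
    have l3 := S.link _ _ b2.symm
    rw [(hcτ p).1] at l2
    rw [S.ts, (hcτ p).2] at l3
    have hf : ({s(φ (U p.1.1), y p.1)} : Set (Sym2 V)) ⊆ E (U p.1.1) (R p.1.2) := by
      rw [Set.singleton_subset_iff]; exact hy2 p.1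
    have d1 : Disjoint ({s(φ (U p.1.1), y p.1)} ∪ Q p.1) (E (R (z p)) (c p)) := by
      rw [Set.disjoint_union_left]
      refine ⟨(S.dis _ _ _ _ (hUR p.1.1 p.1.2) b1 ?_).mono_left hf,
        hBD _ _ (hQ1 _) (hE _ _ b1)⟩
      exact sne (Or.inl b5) (Or.inl b4)
    have d2 : Disjoint (({s(φ (U p.1.1), y p.1)} ∪ Q p.1) ∪ E (R (z p)) (c p))
        (E (c p) (U p.1.2)) := by
      rw [Set.disjoint_union_left, Set.disjoint_union_left]
      refine ⟨⟨(S.dis _ _ _ _ (hUR p.1.1 p.1.2) b2.symm ?_).mono_left hf,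
        hBD _ _ (hQ1 _) (hE _ _ b2.symm)⟩, S.dis _ _ _ _ b1 b2.symm ?_⟩
      · exact sne (Or.inl b4) (Or.inr b3)
      · exact sne (Or.inl b1) (Or.inl b6.symm)
    have l := (l1.trans l2 d1).trans l3 d2
    have l' : Link G _ true (φ (U p.1.1)) (φ (U p.1.2)) := l
    refine l'.mono ?_
    simp only [X]
    intro e he
    simp only [Set.mem_union] at he ⊢
    tauto

theorem odd_of_hasK {G : SimpleGraph V} {s : V → Bool}
    (hcut : ∀ Z, cut (Dg G s) Z ≤ cut (Bg G s) Z) {t : ℕ} (ht : 1 ≤ t)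
    (h : HasK (181 * t) (Dg G s)) : HasTotallyOddImmersion G (⊤ : SimpleGraph (Fin t)) := by
  have hle : Dg G s ≤ G := fun a b h => h.1
  obtain ⟨φ, E, τ, S, hE, hc⟩ := HasK.sys hle h
  by_cases hodd : ∀ Y : Finset (Fin (181 * t)), Y.card = 45 * t →
      (45 * t) ^ 2 < 5 * ((Y ×ˢ Y).filter (fun c => c.1 ≠ c.2 ∧ τ c.1 c.2 = true)).card
  · exact case1 ht rfl S hodd
  · push Not at hodd
    obtain ⟨Y, hY, hY'⟩ := hodd
    exact case2 hcut ht S hE hc Y hY (by convert hY')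

theorem hasK_map {V W : Type*} {n : ℕ} {G : SimpleGraph V} {H : SimpleGraph W} (f : W → V)
    (hf : Function.Injective f) (hadj : ∀ a b, H.Adj a b → G.Adj (f a) (f b)) (h : HasK n H) :
    HasK n G := by
  obtain ⟨φ, hφ, S, hS1, hS2, hS3⟩ := h
  refine ⟨f ∘ φ, hf.comp hφ, fun p => Set.image (Sym2.map f) (S p), ?_, ?_, ?_⟩
  · rintro p hp _ ⟨e, he, rfl⟩
    have := hS1 p hp he
    induction e using Sym2.ind with
    | _ a b => exact hadj a b this
  · intro p q hp hq hpq
    exact (Set.disjoint_image_iff (Sym2.map.injective hf)).2 (hS2 p q hp hq hpq)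
  · intro p hp
    have key : ∀ {a b : W}, (fromEdgeSet (S p)).Walk a b → Conn (Set.image (Sym2.map f) (S p)) (f a) (f b) := by
      intro a b w
      induction w with
      | nil => exact Conn.refl _ _
      | @cons a b c hadj w ih =>
        rw [fromEdgeSet_adj] at hadj
        exact (Conn.edge (S := Set.image (Sym2.map f) (S p)) ⟨s(a, b), hadj.1, rfl⟩).trans ih
    obtain ⟨w⟩ := hS3 p hp
    exact key w

theorem mainResult (t : ℕ) (ht : 1 ≤ t)
    (G : SimpleGraph V) (h : ¬ HasTotallyOddImmersion G (⊤ : SimpleGraph (Fin t))) :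
    ∃ F ⊆ G.edgeSet, (SimpleGraph.fromEdgeSet F).Colorable 2 ∧
      ∀ H : (G.deleteEdges F).Subgraph, H.verts.Nonempty →
        ∃ v ∈ H.verts, (H.neighborSet v).ncard ≤ 686000 * t + 31000000 := by
  obtain ⟨s, hs⟩ := max_cut G
  refine ⟨(Bg G s).edgeSet, edgeSet_mono (fun a b h => h.1), ?_, ?_⟩
  · rw [fromEdgeSet_edgeSet]
    have hcol : (Bg G s).Coloring Bool := Coloring.mk s (fun h => h.2)
    simpa using hcol.colorable
  · intro H hH
    by_contra hcon
    push Not at hcon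
    apply h
    refine odd_of_hasK hs ht ?_
    have hn : Nonempty H.verts := hH.to_subtype
    have hK : HasK (181 * t) H.coe := by
      refine theoremI (by omega) H.coe ?_
      intro v
      have h1 := hcon v.1 v.2
      have h2 : (H.neighborSet v.1).ncard ≤ dg H.coe v := by
        unfold dg
        rw [Set.ncard_eq_toFinset_card']
        have hsub : (H.neighborSet v.1).toFinset ⊆ (nb H.coe v).image Subtype.val := by
          intro w hw
          rw [Set.mem_toFinset] at hw
          have hw' : H.Adj v.1 w := hw
          rw [Finset.mem_image]
          exact ⟨⟨w, hw'.snd_mem⟩, by simpa using hw', rfl⟩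
        exact (Finset.card_le_card hsub).trans Finset.card_image_le
      omega
    refine hasK_map Subtype.val Subtype.val_injective ?_ hK
    intro a b hab
    have hab' : H.Adj a.1 b.1 := hab
    have h1 := hab'.adj_sub
    rw [deleteEdges_adj] at h1
    refine ⟨h1.1, ?_⟩
    by_contra hne
    exact h1.2 ⟨h1.1, hne⟩

end TOI

end

/-- For every integer t ≥ 1, every finite simple graph G with no totally odd
immersion of K_t has a set of edges F ⊆ E(G) such that G[F] is bipartite and G ∖ F is
(686000·t + 31000000)-degenerate: every nonempty subgraph has a vertex of degree at most
686000·t + 31000000. -/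
theorem totally_odd_immersion_free_bipartite_plus_degenerate {V : Type*} [Fintype V]
    (t : ℕ) (ht : 1 ≤ t)
    (G : SimpleGraph V) (h : ¬ HasTotallyOddImmersion G (⊤ : SimpleGraph (Fin t))) :
    ∃ F ⊆ G.edgeSet, (SimpleGraph.fromEdgeSet F).Colorable 2 ∧
      ∀ H : (G.deleteEdges F).Subgraph, H.verts.Nonempty →
        ∃ v ∈ H.verts, (H.neighborSet v).ncard ≤ 686000 * t + 31000000 := by
  exact TOI.mainResult t ht G h
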